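/- arXiv:1501.06975 — 2 statements merged into one kernel-verified Lean document; each statement's English description precedes it below -/
import Mathlib

section
/- There is a positive, effective absolute constant C such that for every imaginary quadratic field K and every nonzero ideal 𝔞 of the ring of integers O_K with |𝔞| ≥ 3, one has φ_K(𝔞) ≥ (C / h_K) · |𝔞| / log log |𝔞|. -/
open NumberField

theorem Nat.pow_dvd_factorial_mul (q k : ℕ) (hq : q ≠ 0) : q ^ k ∣ (q * k).factorial := by
  induction k with
  | zero => simp
  | succ k ih =>
    rw [pow_succ, mul_add_one]
    exact (mul_dvd_mul ih (Nat.dvd_factorial (Nat.pos_of_ne_zero hq) le_rfl)).trans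
      (Nat.factorial_mul_factorial_dvd_factorial_add _ _)

theorem Finset.prod_sq_div_sq_sub_one_le (s : Finset ℕ) (hs : ∀ q ∈ s, 2 ≤ q) :
    ∏ q ∈ s, (q : ℝ) ^ 2 / ((q : ℝ) ^ 2 - 1) ≤ 2 := by
  have hf (q : ℕ) (hq : 2 ≤ q) : 1 ≤ (q : ℝ) ^ 2 / ((q : ℝ) ^ 2 - 1) := by
    have : (2 : ℝ) ≤ q := by exact_mod_cast hq
    rw [one_le_div (by nlinarith)]
    linarith
  have htel (m : ℕ) : ∏ i ∈ Finset.range m, ((2 + i : ℕ) : ℝ) ^ 2 / (((2 + i : ℕ) : ℝ) ^ 2 - 1) =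
      2 * ((m : ℝ) + 1) / ((m : ℝ) + 2) := by
    induction m with
    | zero => simp
    | succ m ih =>
      rw [Finset.prod_range_succ, ih]
      push_cast
      have h : ((2 : ℝ) + m) ^ 2 - 1 = (m + 1) * (m + 3) := by ring
      rw [h]
      field_simp
      ring
  set m := s.sup id
  have hsub : s ⊆ Finset.Ico 2 (2 + m) := fun q hq ↦ by
    have : q ≤ m := Finset.le_sup (f := id) hq
    exact Finset.mem_Ico.2 ⟨hs q hq, by omega⟩
  calc _ ≤ ∏ q ∈ Finset.Ico 2 (2 + m), (q : ℝ) ^ 2 / ((q : ℝ) ^ 2 - 1) :=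
        Finset.prod_le_prod_of_subset_of_one_le hsub
          (fun q hq ↦ zero_le_one.trans (hf q (hs q hq)))
          (fun q hq _ ↦ hf q (Finset.mem_Ico.1 hq).1)
    _ = 2 * ((m : ℝ) + 1) / ((m : ℝ) + 2) := by
        rw [Finset.prod_Ico_eq_prod_range, Nat.add_sub_cancel_left, htel]
    _ ≤ 2 := by
        rw [div_le_iff₀ (by positivity)]
        linarith

section NumberField

variable {K : Type*} [Field K] [NumberField K]

theorem NumberField.absNorm_prime_two_le {P : Ideal (𝓞 K)} (hP : Prime P) :
    2 ≤ Ideal.absNorm P := by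
  have h0 : Ideal.absNorm P ≠ 0 := Ideal.absNorm_eq_zero_iff.not.2 hP.ne_zero
  have h1 : Ideal.absNorm P ≠ 1 := by
    rw [Ne, Ideal.absNorm_eq_one_iff, ← Ideal.one_eq_top]
    exact hP.ne_one
  omega

theorem Ideal.one_sub_inv_mul_le_card_units_quotient_pow {P : Ideal (𝓞 K)} (hP : Prime P)
    {n : ℕ} (hn : n ≠ 0) :
    (Ideal.absNorm (P ^ n) : ℝ) * (1 - (Ideal.absNorm P : ℝ)⁻¹) ≤ Nat.card (𝓞 K ⧸ P ^ n)ˣ := by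
  have hmax : P.IsMaximal := (Ideal.isPrime_of_prime hP).isMaximal hP.ne_zero
  have hfin : Finite (𝓞 K ⧸ P ^ n) := by
    rw [← Ideal.absNorm_ne_zero_iff, Ne, Ideal.absNorm_eq_zero_iff]
    exact pow_ne_zero _ hP.ne_zero
  let f : 𝓞 K ⧸ P ^ n →+* 𝓞 K ⧸ P := Ideal.Quotient.factor (Ideal.pow_le_self hn)
  have hf : Function.Surjective f := Ideal.Quotient.factor_surjective _
  have hker : Ideal.absNorm P * Nat.card f.toAddMonoidHom.ker = Ideal.absNorm (P ^ n) := by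
    have h := AddSubgroup.card_mul_index f.toAddMonoidHom.ker
    have hrange : f.toAddMonoidHom.range = ⊤ := AddMonoidHom.range_eq_top.2 hf
    rw [AddSubgroup.index_ker, hrange] at h
    rw [mul_comm, Ideal.absNorm_apply, Submodule.cardQuot_apply, Ideal.absNorm_apply,
      Submodule.cardQuot_apply, ← h]
    congr 1
    exact (Nat.card_congr AddSubgroup.topEquiv.toEquiv).symm
  have hunit (x : 𝓞 K ⧸ P ^ n) : x ∈ f.toAddMonoidHom.ker ↔ ¬ IsUnit x := by
    obtain ⟨x, rfl⟩ := Ideal.Quotient.mk_surjective x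
    rw [Ideal.Quotient.isUnit_mk_pow_iff_notMem P hn, not_not]
    exact Ideal.Quotient.eq_zero_iff_mem
  have hsum : Nat.card f.toAddMonoidHom.ker + Nat.card (𝓞 K ⧸ P ^ n)ˣ = Ideal.absNorm (P ^ n) := by
    have h1 : Nat.card (𝓞 K ⧸ P ^ n)ˣ = Nat.card {x : 𝓞 K ⧸ P ^ n // IsUnit x} :=
      Nat.card_congr Submonoid.unitsTypeEquivIsUnitSubmonoid.toEquiv
    have h2 : Nat.card f.toAddMonoidHom.ker = Nat.card {x : 𝓞 K ⧸ P ^ n // ¬ IsUnit x} :=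
      Nat.card_congr (Equiv.subtypeEquivRight hunit)
    classical
    rw [h1, h2, add_comm, ← Nat.card_sum, Nat.card_congr (Equiv.sumCompl _), Ideal.absNorm_apply,
      Submodule.cardQuot_apply]
  have hpos : (0 : ℝ) < Ideal.absNorm P := by
    exact_mod_cast (zero_lt_two.trans_le (NumberField.absNorm_prime_two_le hP))
  have h1 : (Ideal.absNorm P : ℝ) * Nat.card f.toAddMonoidHom.ker = Ideal.absNorm (P ^ n) := by
    exact_mod_cast hker
  have h2 : (Nat.card f.toAddMonoidHom.ker : ℝ) + Nat.card (𝓞 K ⧸ P ^ n)ˣ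
      = Ideal.absNorm (P ^ n) := by
    exact_mod_cast hsum
  have h3 : (Ideal.absNorm (P ^ n) : ℝ) * (Ideal.absNorm P : ℝ)⁻¹
      = Nat.card f.toAddMonoidHom.ker := by
    rw [← h1]; field_simp
  linarith

open UniqueFactorizationMonoid in
theorem Ideal.absNorm_mul_prod_le_card_units_quotient [DecidableEq (Ideal (𝓞 K))]
    {𝔞 : Ideal (𝓞 K)} (h𝔞 : 𝔞 ≠ ⊥) :
    (Ideal.absNorm 𝔞 : ℝ) * ∏ P ∈ (factors 𝔞).toFinset, (1 - (Ideal.absNorm P : ℝ)⁻¹) ≤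
      Nat.card (𝓞 K ⧸ 𝔞)ˣ := by
  classical
  have hprod : ∏ P ∈ (factors 𝔞).toFinset, P ^ (factors 𝔞).count P = 𝔞 := by
    rw [← Finset.prod_multiset_count]
    exact associated_iff_eq.1 (factors_prod h𝔞)
  have e : 𝓞 K ⧸ 𝔞 ≃+*
      ∀ P : (factors 𝔞).toFinset, 𝓞 K ⧸ (P : Ideal (𝓞 K)) ^ (factors 𝔞).count P.1 :=
    IsDedekindDomain.quotientEquivPiOfFinsetProdEq 𝔞 id (fun P ↦ (factors 𝔞).count P)
      (fun P hP ↦ prime_of_factor _ (Multiset.mem_toFinset.1 hP)) (fun _ _ _ _ h ↦ h) hprod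
  rw [Nat.card_congr ((Units.mapEquiv e.toMulEquiv).trans MulEquiv.piUnits).toEquiv, Nat.card_pi]
  nth_rw 1 [← hprod]
  rw [map_prod, Nat.cast_prod, ← Finset.prod_mul_distrib, Nat.cast_prod,
    ← Finset.prod_coe_sort (factors 𝔞).toFinset]
  refine Finset.prod_le_prod (fun P _ ↦ ?_) (fun P _ ↦ ?_)
  · refine mul_nonneg (by positivity) (sub_nonneg.2 (inv_le_one_of_one_le₀ ?_))
    have := NumberField.absNorm_prime_two_le (prime_of_factor _ (Multiset.mem_toFinset.1 P.2))
    exact_mod_cast one_le_two.trans this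
  · exact one_sub_inv_mul_le_card_units_quotient_pow
      (prime_of_factor _ (Multiset.mem_toFinset.1 P.2))
      (Multiset.count_ne_zero.2 (Multiset.mem_toFinset.1 P.2))

theorem Ideal.prod_pow_dvd_of_prime (S : Finset (Ideal (𝓞 K))) (hS : ∀ P ∈ S, Prime P)
    (e : Ideal (𝓞 K) → ℕ) {I : Ideal (𝓞 K)} (h : ∀ P ∈ S, P ^ e P ∣ I) : ∏ P ∈ S, P ^ e P ∣ I := by
  refine Finset.prod_dvd_of_isRelPrime (fun P hP Q hQ hne ↦ ?_) h
  refine IsRelPrime.pow ((hS P hP).irreducible.isRelPrime_iff_not_dvd.2 fun hdvd ↦ hne ?_)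
  exact associated_iff_eq.1 ((hS P hP).associated_of_dvd (hS Q hQ) hdvd)

theorem NumberField.sum_log_absNorm_div_le (hK : Module.finrank ℚ K = 2)
    (S : Finset (Ideal (𝓞 K))) (hS : ∀ P ∈ S, Prime P) {n : ℕ} (hn : n ≠ 0)
    (hSn : ∀ P ∈ S, Ideal.absNorm P ≤ n) :
    ∑ P ∈ S, Real.log (Ideal.absNorm P) / Ideal.absNorm P ≤ 4 * Real.log n := by
  have hdvd : ∏ P ∈ S, P ^ (n / Ideal.absNorm P) ∣ Ideal.span {((n.factorial : ℕ) : 𝓞 K)} := by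
    refine Ideal.prod_pow_dvd_of_prime S hS (fun P ↦ n / Ideal.absNorm P) fun P hP ↦ ?_
    rw [Ideal.dvd_span_singleton]
    have h2 := absNorm_prime_two_le (hS P hP)
    obtain ⟨c, hc⟩ := (Nat.pow_dvd_factorial_mul (Ideal.absNorm P) (n / Ideal.absNorm P)
      (by omega)).trans (Nat.factorial_dvd_factorial (Nat.mul_div_le n _))
    rw [hc, Nat.cast_mul, Nat.cast_pow]
    exact Ideal.mul_mem_right _ _ (Ideal.pow_mem_pow (Ideal.absNorm_mem P) _)
  have hle : ∏ P ∈ S, Ideal.absNorm P ^ (n / Ideal.absNorm P) ≤ n ^ (2 * n) := by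
    have h := map_dvd Ideal.absNorm hdvd
    rw [map_prod, Ideal.absNorm_span_natCast, RingOfIntegers.rank, hK] at h
    simp only [map_pow] at h
    calc _ ≤ n.factorial ^ 2 := Nat.le_of_dvd (by positivity) h
      _ ≤ (n ^ n) ^ 2 := by gcongr; exact Nat.factorial_le_pow n
      _ = n ^ (2 * n) := by rw [← pow_mul, mul_comm]
  have hpos : ∀ P ∈ S, (0 : ℝ) < Ideal.absNorm P := fun P hP ↦ by
    exact_mod_cast zero_lt_two.trans_le (absNorm_prime_two_le (hS P hP))
  have hn0 : (0 : ℝ) < n := by positivity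
  have hlog : ∑ P ∈ S, (n / Ideal.absNorm P : ℕ) * Real.log (Ideal.absNorm P) ≤
      2 * n * Real.log n := by
    have h : ((∏ P ∈ S, Ideal.absNorm P ^ (n / Ideal.absNorm P) : ℕ) : ℝ) ≤ (n : ℝ) ^ (2 * n) := by
      exact_mod_cast hle
    push_cast at h
    have h' := Real.log_le_log (Finset.prod_pos fun P hP ↦ pow_pos (hpos P hP) _) h
    rw [Real.log_prod (fun P hP ↦ (pow_pos (hpos P hP) _).ne'), Real.log_pow] at h'
    simp only [Real.log_pow] at h'
    exact_mod_cast h'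
  have hterm : ∀ P ∈ S, Real.log (Ideal.absNorm P) / Ideal.absNorm P ≤
      2 / n * ((n / Ideal.absNorm P : ℕ) * Real.log (Ideal.absNorm P)) := by
    intro P hP
    have h2 := absNorm_prime_two_le (hS P hP)
    have hdiv : n ≤ 2 * (n / Ideal.absNorm P) * Ideal.absNorm P := by
      have h1 := Nat.div_add_mod n (Ideal.absNorm P)
      have h3 := Nat.mod_lt n (show Ideal.absNorm P > 0 by omega)
      have h4 : 1 ≤ n / Ideal.absNorm P := Nat.div_pos (hSn P hP) (by omega)
      nlinarith
    have hdiv' : (n : ℝ) ≤ 2 * (n / Ideal.absNorm P : ℕ) * Ideal.absNorm P := by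
      exact_mod_cast hdiv
    have hl : 0 ≤ Real.log (Ideal.absNorm P) := Real.log_natCast_nonneg _
    rw [← mul_assoc, div_mul_eq_mul_div, div_eq_inv_mul]
    gcongr
    rw [inv_le_iff_one_le_mul₀ (hpos P hP), div_mul_eq_mul_div, one_le_div hn0]
    exact hdiv'
  calc _ ≤ ∑ P ∈ S, 2 / n * ((n / Ideal.absNorm P : ℕ) * Real.log (Ideal.absNorm P)) :=
        Finset.sum_le_sum hterm
    _ ≤ 2 / n * (2 * n * Real.log n) := by
        rw [← Finset.mul_sum]
        gcongr
    _ = 4 * Real.log n := by field_simp; ring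

theorem NumberField.prod_absNorm_sq_div_le (hK : Module.finrank ℚ K = 2)
    (S : Finset (Ideal (𝓞 K))) (hS : ∀ P ∈ S, Prime P) :
    ∏ P ∈ S, (Ideal.absNorm P : ℝ) ^ 2 / ((Ideal.absNorm P : ℝ) ^ 2 - 1) ≤ 4 := by
  classical
  have h2 : ∀ q ∈ S.image Ideal.absNorm, 2 ≤ q :=
    Finset.forall_mem_image.2 fun P hP ↦ absNorm_prime_two_le (hS P hP)
  have hf (q : ℕ) (hq : 2 ≤ q) : 1 ≤ (q : ℝ) ^ 2 / ((q : ℝ) ^ 2 - 1) := by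
    have : (2 : ℝ) ≤ q := by exact_mod_cast hq
    rw [one_le_div (by nlinarith)]
    linarith
  have hcard : ∀ q ∈ S.image Ideal.absNorm, (S.filter fun P ↦ Ideal.absNorm P = q).card ≤ 2 := by
    intro q hq
    have hdvd : ∏ P ∈ S with Ideal.absNorm P = q, P ^ 1 ∣ Ideal.span {(q : 𝓞 K)} := by
      refine Ideal.prod_pow_dvd_of_prime _ (fun P hP ↦ hS P (Finset.mem_filter.1 hP).1)
        (fun _ ↦ 1) fun P hP ↦ ?_
      rw [pow_one, Ideal.dvd_span_singleton, ← (Finset.mem_filter.1 hP).2]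
      exact Ideal.absNorm_mem P
    have h := map_dvd Ideal.absNorm hdvd
    rw [map_prod, Ideal.absNorm_span_natCast, RingOfIntegers.rank, hK] at h
    simp only [pow_one] at h
    rw [Finset.prod_congr rfl (fun P hP ↦ (Finset.mem_filter.1 hP).2), Finset.prod_const] at h
    exact (Nat.pow_dvd_pow_iff_le_right (h2 q hq)).1 h
  have := Finset.prod_sq_div_sq_sub_one_le _ h2
  rw [Finset.prod_comp (fun q : ℕ ↦ (q : ℝ) ^ 2 / ((q : ℝ) ^ 2 - 1)) Ideal.absNorm]
  calc _ ≤ ∏ q ∈ S.image Ideal.absNorm, ((q : ℝ) ^ 2 / ((q : ℝ) ^ 2 - 1)) ^ 2 := by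
        refine Finset.prod_le_prod (fun q hq ↦ ?_) fun q hq ↦ ?_
        · exact pow_nonneg (zero_le_one.trans (hf q (h2 q hq))) _
        · exact pow_le_pow_right₀ (hf q (h2 q hq)) (hcard q hq)
    _ ≤ 2 ^ 2 := by
        rw [Finset.prod_pow]
        exact pow_le_pow_left₀ (Finset.prod_nonneg fun q hq ↦ zero_le_one.trans (hf q (h2 q hq)))
          this 2
    _ = 4 := by norm_num

end NumberField

theorem Complex.card_le_of_separated (A : Finset ℂ) {c t : ℝ} (hc : 0 < c) (ht : 1 ≤ t)
    (hA : ∀ z ∈ A, ‖z‖ ^ 2 ≤ c * t) (hsep : ∀ z ∈ A, ∀ w ∈ A, z ≠ w → c ≤ ‖z - w‖ ^ 2) :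
    (A.card : ℝ) ≤ 36 * t := by
  set s := √c with hs
  set r := √t with hr
  have hs0 : 0 < s := Real.sqrt_pos.2 hc
  have hs2 : s ^ 2 = c := Real.sq_sqrt hc.le
  have hr2 : r ^ 2 = t := Real.sq_sqrt (by linarith)
  have hr1 : 1 ≤ r := Real.one_le_sqrt.2 ht
  have hbound (x : ℝ) (hx : x ^ 2 ≤ c * t) : ⌊2 * x / s⌋ ∈ Finset.Icc ⌊-(2 * r)⌋ ⌊2 * r⌋ := by
    have hx' : |x| ≤ s * r := abs_le_of_sq_le_sq
      (by rw [mul_pow, hs2, hr2]; exact hx) (by positivity)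
    obtain ⟨h1, h2⟩ := abs_le.1 hx'
    refine Finset.mem_Icc.2 ⟨Int.floor_le_floor ?_, Int.floor_le_floor ?_⟩
    · rw [le_div_iff₀ hs0]; linarith
    · rw [div_le_iff₀ hs0]; linarith
  have hclose (x y : ℝ) (h : ⌊2 * x / s⌋ = ⌊2 * y / s⌋) : (x - y) ^ 2 < c / 4 := by
    have h1 := Int.abs_sub_lt_one_of_floor_eq_floor h
    rw [← sub_div, abs_div, abs_of_pos hs0, div_lt_one hs0, ← mul_sub, abs_mul, abs_two] at h1
    have := sq_lt_sq' (by linarith [abs_nonneg (x - y)]) h1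
    rw [mul_pow, sq_abs, hs2] at this
    linarith
  have hnorm (z : ℂ) : ‖z‖ ^ 2 = z.re ^ 2 + z.im ^ 2 := by
    rw [Complex.sq_norm, Complex.normSq_apply]; ring
  have hcard : A.card ≤ (Finset.Icc ⌊-(2 * r)⌋ ⌊2 * r⌋ ×ˢ Finset.Icc ⌊-(2 * r)⌋ ⌊2 * r⌋).card := by
    refine Finset.card_le_card_of_injOn (fun z ↦ (⌊2 * z.re / s⌋, ⌊2 * z.im / s⌋)) ?_ ?_
    · intro z hz
      have := hA z hz
      rw [hnorm] at this
      exact Finset.mem_product.2 ⟨hbound _ (by nlinarith [sq_nonneg z.im]),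
        hbound _ (by nlinarith [sq_nonneg z.re])⟩
    · intro z hz w hw h
      by_contra hne
      have h1 := hsep z hz w hw hne
      rw [hnorm, Complex.sub_re, Complex.sub_im] at h1
      have h2 := hclose _ _ (congrArg Prod.fst h)
      have h3 := hclose _ _ (congrArg Prod.snd h)
      linarith
  have hside : ((Finset.Icc ⌊-(2 * r)⌋ ⌊2 * r⌋).card : ℝ) ≤ 6 * r := by
    have hle : ⌊-(2 * r)⌋ ≤ ⌊2 * r⌋ + 1 := by
      have : ⌊-(2 * r)⌋ ≤ ⌊2 * r⌋ := Int.floor_le_floor (by linarith)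
      linarith
    have := Int.card_Icc_of_le _ _ hle
    have : ((Finset.Icc ⌊-(2 * r)⌋ ⌊2 * r⌋).card : ℝ) = ⌊2 * r⌋ + 1 - ⌊-(2 * r)⌋ := by
      exact_mod_cast this
    rw [this]
    linarith [Int.floor_le (2 * r), Int.lt_floor_add_one (-(2 * r))]
  calc (A.card : ℝ) ≤ ((Finset.Icc ⌊-(2 * r)⌋ ⌊2 * r⌋).card : ℝ) ^ 2 := by
        rw [Finset.card_product] at hcard
        rw [sq]; exact_mod_cast hcard
    _ ≤ (6 * r) ^ 2 := by gcongr
    _ = 36 * t := by rw [mul_pow, hr2]; norm_num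

section ImaginaryQuadratic

variable {K : Type*} [Field K] [NumberField K]

theorem NumberField.sq_norm_embedding_eq_absNorm (hK : Module.finrank ℚ K = 2)
    (hR : IsEmpty (K →+* ℝ)) (φ : K →+* ℂ) (x : 𝓞 K) :
    ‖φ x‖ ^ 2 = Ideal.absNorm (Ideal.span {x}) := by
  have hreal (w : InfinitePlace K) : w.IsComplex := by
    rw [← InfinitePlace.not_isReal_iff_isComplex]
    exact fun hw ↦ hR.false (InfinitePlace.embedding_of_isReal hw)
  have : IsTotallyComplex K := ⟨hreal⟩
  have hcard : Fintype.card (InfinitePlace K) = 1 := by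
    have h1 := IsTotallyComplex.finrank K
    have h2 := InfinitePlace.card_eq_nrRealPlaces_add_nrComplexPlaces K
    rw [IsTotallyComplex.nrRealPlaces_eq_zero] at h2
    omega
  obtain ⟨w₀, hw₀⟩ := Fintype.card_eq_one_iff.1 hcard
  have h := InfinitePlace.prod_eq_abs_norm (x : K)
  rw [Fintype.prod_eq_single (InfinitePlace.mk φ)
    (fun w hw ↦ absurd ((hw₀ w).trans (hw₀ _).symm) hw)] at h
  rw [IsTotallyComplex.mult_eq, InfinitePlace.apply] at h
  rw [h, Ideal.absNorm_span_singleton, ← Algebra.coe_norm_int, Nat.cast_natAbs]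
  push_cast
  rfl

theorem NumberField.card_le_of_mul_isPrincipal (hK : Module.finrank ℚ K = 2)
    (hR : IsEmpty (K →+* ℝ)) {𝔟 : Ideal (𝓞 K)} (h𝔟 : 𝔟 ≠ ⊥) (F : Finset (Ideal (𝓞 K)))
    {t : ℝ} (ht : 1 ≤ t) (hF : ∀ 𝔞 ∈ F, (Ideal.absNorm 𝔞 : ℝ) ≤ t)
    (hp : ∀ 𝔞 ∈ F, (𝔞 * 𝔟).IsPrincipal) : (F.card : ℝ) ≤ 36 * t := by
  classical
  obtain ⟨φ⟩ : Nonempty (K →+* ℂ) := inferInstance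
  have hgen : ∀ 𝔞 : Ideal (𝓞 K), ∃ g : 𝓞 K, 𝔞 ∈ F → 𝔞 * 𝔟 = Ideal.span {g} := by
    intro 𝔞
    by_cases h : 𝔞 ∈ F
    · obtain ⟨g, hg⟩ := hp 𝔞 h
      exact ⟨g, fun _ ↦ hg⟩
    · exact ⟨0, fun h' ↦ absurd h' h⟩
  choose g hg using hgen
  have hgmem : ∀ 𝔞 ∈ F, g 𝔞 ∈ 𝔟 := fun 𝔞 h ↦
    Ideal.mul_le_right (I := 𝔞) (hg 𝔞 h ▸ Ideal.mem_span_singleton_self (g 𝔞))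
  have hinj : Set.InjOn (fun 𝔞 ↦ φ (g 𝔞)) F := by
    intro 𝔞 h 𝔞' h' heq
    have : g 𝔞 = g 𝔞' := RingOfIntegers.ext (φ.injective heq)
    have h2 := hg 𝔞 h
    rw [this, ← hg 𝔞' h'] at h2
    exact mul_right_cancel₀ h𝔟 h2
  rw [← Finset.card_image_of_injOn hinj]
  have hpos : 0 < Ideal.absNorm 𝔟 := Nat.pos_of_ne_zero (Ideal.absNorm_eq_zero_iff.not.2 h𝔟)
  refine Complex.card_le_of_separated _ (c := Ideal.absNorm 𝔟) (by exact_mod_cast hpos) ht ?_ ?_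
  · simp only [Finset.forall_mem_image]
    intro 𝔞 h
    rw [sq_norm_embedding_eq_absNorm hK hR, ← hg 𝔞 h, map_mul, Nat.cast_mul, mul_comm]
    gcongr
    exact hF 𝔞 h
  · simp only [Finset.forall_mem_image]
    intro 𝔞 h 𝔞' h' hne
    rw [← map_sub, ← map_sub, sq_norm_embedding_eq_absNorm hK hR]
    have hle : Ideal.span {g 𝔞 - g 𝔞'} ≤ 𝔟 := by
      rw [Ideal.span_singleton_le_iff_mem]
      exact sub_mem (hgmem 𝔞 h) (hgmem 𝔞' h')
    have hne' : g 𝔞 - g 𝔞' ≠ 0 := fun h0 ↦ hne (by rw [sub_eq_zero.1 h0])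
    have h0 : Ideal.absNorm (Ideal.span {g 𝔞 - g 𝔞'}) ≠ 0 := by
      rwa [Ne, Ideal.absNorm_eq_zero_iff, Ideal.span_singleton_eq_bot]
    exact_mod_cast Nat.le_of_dvd (Nat.pos_of_ne_zero h0) (Ideal.absNorm_dvd_absNorm_of_le hle)

theorem NumberField.card_ideals_le (hK : Module.finrank ℚ K = 2)
    (hR : IsEmpty (K →+* ℝ)) (F : Finset (Ideal (𝓞 K))) {t : ℝ} (ht : 1 ≤ t)
    (h0 : ∀ 𝔞 ∈ F, 𝔞 ≠ ⊥) (hF : ∀ 𝔞 ∈ F, (Ideal.absNorm 𝔞 : ℝ) ≤ t) :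
    (F.card : ℝ) ≤ classNumber K * (36 * t) := by
  classical
  choose rep hrep using ClassGroup.mk0_surjective (R := 𝓞 K)
  have hsub : F ⊆ Finset.univ.biUnion
      fun c ↦ F.filter fun 𝔞 ↦ (𝔞 * (rep c : Ideal (𝓞 K))).IsPrincipal := by
    intro 𝔞 h
    simp only [Finset.mem_biUnion, Finset.mem_univ, true_and, Finset.mem_filter]
    set 𝔞' : nonZeroDivisors (Ideal (𝓞 K)) := ⟨𝔞, mem_nonZeroDivisors_of_ne_zero (h0 𝔞 h)⟩
    refine ⟨(ClassGroup.mk0 𝔞')⁻¹, h, ?_⟩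
    refine (ClassGroup.mk0_eq_one_iff (𝔞' * rep (ClassGroup.mk0 𝔞')⁻¹).2).1 ?_
    exact (map_mul ClassGroup.mk0 𝔞' _).trans (by rw [hrep, mul_inv_cancel])
  calc (F.card : ℝ)
    _ ≤ ∑ c, ((F.filter fun 𝔞 ↦ (𝔞 * (rep c : Ideal (𝓞 K))).IsPrincipal).card : ℝ) := by
        exact_mod_cast (Finset.card_le_card hsub).trans Finset.card_biUnion_le
    _ ≤ ∑ _c : ClassGroup (𝓞 K), 36 * t := by
        refine Finset.sum_le_sum fun c _ ↦ card_le_of_mul_isPrincipal hK hR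
          (nonZeroDivisors.coe_ne_zero (rep c)) _ ht ?_ ?_
        · exact fun 𝔞 h ↦ hF 𝔞 (Finset.mem_filter.1 h).1
        · exact fun 𝔞 h ↦ (Finset.mem_filter.1 h).2
    _ = classNumber K * (36 * t) := by
        rw [Finset.sum_const, Finset.card_univ, nsmul_eq_mul, classNumber]

theorem NumberField.sum_absNorm_rpow_le (hK : Module.finrank ℚ K = 2)
    (hR : IsEmpty (K →+* ℝ)) (F : Finset (Ideal (𝓞 K))) (h0 : ∀ 𝔞 ∈ F, 𝔞 ≠ ⊥)
    {δ : ℝ} (hδ : 0 < δ) (hδ1 : δ ≤ 1) :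
    ∑ 𝔞 ∈ F, (Ideal.absNorm 𝔞 : ℝ) ^ (-(1 + δ)) ≤ classNumber K * (144 / δ) := by
  classical
  have hpos : ∀ 𝔞 ∈ F, Ideal.absNorm 𝔞 ≠ 0 := fun 𝔞 h ↦ Ideal.absNorm_eq_zero_iff.not.2 (h0 𝔞 h)
  set m := F.sup (fun 𝔞 ↦ Nat.log 2 (Ideal.absNorm 𝔞)) + 1
  have hmaps : ∀ 𝔞 ∈ F, Nat.log 2 (Ideal.absNorm 𝔞) ∈ Finset.range m := fun 𝔞 h ↦
    Finset.mem_range.2 <| Nat.lt_succ_of_le <|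
      Finset.le_sup (f := fun 𝔞 ↦ Nat.log 2 (Ideal.absNorm 𝔞)) h
  set r : ℝ := (1 / 2) ^ δ with hr
  have hr0 : 0 ≤ r := by positivity
  have hr1 : r ≤ 1 - δ / 2 := by
    have := rpow_one_add_le_one_add_mul_self (s := -1 / 2) (by norm_num) hδ.le hδ1
    norm_num at this
    rw [hr]; norm_num; linarith
  have hblock (k : ℕ) : ∑ 𝔞 ∈ F with Nat.log 2 (Ideal.absNorm 𝔞) = k,
      (Ideal.absNorm 𝔞 : ℝ) ^ (-(1 + δ)) ≤ classNumber K * 72 * r ^ k := by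
    have h2k : (0 : ℝ) < 2 ^ k := by positivity
    have hval : ((2 : ℝ) ^ k) ^ (-(1 + δ)) = (2 ^ k)⁻¹ * r ^ k := by
      rw [neg_add, Real.rpow_add h2k, Real.rpow_neg_one, hr, Real.rpow_neg h2k.le,
        ← Real.rpow_natCast, ← Real.rpow_natCast, ← Real.rpow_mul (by norm_num),
        ← Real.rpow_mul (by norm_num), one_div, Real.inv_rpow (by norm_num), mul_comm (k : ℝ) δ]
    calc _ ≤ ∑ 𝔞 ∈ F with Nat.log 2 (Ideal.absNorm 𝔞) = k, ((2 : ℝ) ^ k) ^ (-(1 + δ)) := by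
          refine Finset.sum_le_sum fun 𝔞 h ↦ ?_
          obtain ⟨h', rfl⟩ := Finset.mem_filter.1 h
          refine Real.rpow_le_rpow_of_nonpos h2k ?_ (by linarith)
          exact_mod_cast Nat.pow_log_le_self 2 (hpos 𝔞 h')
      _ = ((F.filter fun 𝔞 ↦ Nat.log 2 (Ideal.absNorm 𝔞) = k).card : ℝ) * ((2 ^ k)⁻¹ * r ^ k) := by
          rw [Finset.sum_const, nsmul_eq_mul, hval]
      _ ≤ (classNumber K * (36 * 2 ^ (k + 1))) * ((2 ^ k)⁻¹ * r ^ k) := by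
          gcongr
          refine card_ideals_le hK hR _ (one_le_pow₀ (by norm_num)) ?_ ?_
          · exact fun 𝔞 h ↦ h0 𝔞 (Finset.mem_filter.1 h).1
          · intro 𝔞 h
            obtain ⟨h, rfl⟩ := Finset.mem_filter.1 h
            exact_mod_cast (Nat.lt_pow_succ_log_self (by norm_num) _).le
      _ = classNumber K * 72 * r ^ k := by field_simp; ring
  calc _ = ∑ k ∈ Finset.range m, ∑ 𝔞 ∈ F with Nat.log 2 (Ideal.absNorm 𝔞) = k,
        (Ideal.absNorm 𝔞 : ℝ) ^ (-(1 + δ)) := (Finset.sum_fiberwise_of_maps_to hmaps _).symm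
    _ ≤ ∑ k ∈ Finset.range m, classNumber K * 72 * r ^ k := Finset.sum_le_sum fun k _ ↦ hblock k
    _ = classNumber K * 72 * ∑ k ∈ Finset.range m, r ^ k := by rw [Finset.mul_sum]
    _ ≤ classNumber K * 72 * (1 - r)⁻¹ := by
        gcongr
        rw [← tsum_geometric_of_lt_one hr0 (by linarith)]
        exact (summable_geometric_of_lt_one hr0 (by linarith)).sum_le_tsum _ fun _ _ ↦ by positivity
    _ ≤ classNumber K * 72 * (δ / 2)⁻¹ := by gcongr; linarith
    _ = classNumber K * (144 / δ) := by field_simp; ring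

end ImaginaryQuadratic

section ImaginaryQuadraticEuler

variable {K : Type*} [Field K] [NumberField K]

theorem NumberField.prod_one_add_absNorm_rpow_le (hK : Module.finrank ℚ K = 2)
    (hR : IsEmpty (K →+* ℝ)) (S : Finset (Ideal (𝓞 K))) (hS : ∀ P ∈ S, Prime P)
    {δ : ℝ} (hδ : 0 < δ) (hδ1 : δ ≤ 1) :
    ∏ P ∈ S, (1 + (Ideal.absNorm P : ℝ) ^ (-(1 + δ))) ≤ classNumber K * (144 / δ) := by
  classical
  have hmem {T : Finset (Ideal (𝓞 K))} (hT : T ⊆ S) {P : Ideal (𝓞 K)} (hP : P ∈ S) :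
      P ∈ T ↔ P ∣ ∏ Q ∈ T, Q := by
    refine ⟨fun h ↦ Finset.dvd_prod_of_mem _ h, fun h ↦ ?_⟩
    obtain ⟨Q, hQ, hdvd⟩ := (hS P hP).exists_mem_finset_dvd h
    rwa [associated_iff_eq.1 ((hS P hP).associated_of_dvd (hS Q (hT hQ)) hdvd)]
  have hinj : Set.InjOn (fun T : Finset (Ideal (𝓞 K)) ↦ ∏ P ∈ T, P) S.powerset := by
    intro T hT T' hT' h
    replace hT := Finset.mem_powerset.1 hT
    replace hT' := Finset.mem_powerset.1 hT'
    ext P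
    by_cases hP : P ∈ S
    · rw [hmem hT hP, hmem hT' hP]
      exact iff_of_eq (congrArg (P ∣ ·) h)
    · exact iff_of_false (fun h ↦ hP (hT h)) (fun h ↦ hP (hT' h))
  rw [Finset.prod_one_add]
  calc _ = ∑ T ∈ S.powerset, (Ideal.absNorm (∏ P ∈ T, P) : ℝ) ^ (-(1 + δ)) := by
        refine Finset.sum_congr rfl fun T _ ↦ ?_
        rw [Real.finsetProd_rpow _ _ fun _ _ ↦ Nat.cast_nonneg _, map_prod, Nat.cast_prod]
    _ = ∑ 𝔞 ∈ S.powerset.image (fun T ↦ ∏ P ∈ T, P), (Ideal.absNorm 𝔞 : ℝ) ^ (-(1 + δ)) :=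
        (Finset.sum_image (f := fun 𝔞 ↦ (Ideal.absNorm 𝔞 : ℝ) ^ (-(1 + δ))) hinj).symm
    _ ≤ _ := by
        refine sum_absNorm_rpow_le hK hR _ (Finset.forall_mem_image.2 fun T hT ↦ ?_) hδ hδ1
        exact Finset.prod_ne_zero_iff.2 fun P hP ↦ (hS P (Finset.mem_powerset.1 hT hP)).ne_zero

theorem one_add_inv_le_mul_exp {q δ : ℝ} (hq : 1 ≤ q) (hδ : 0 ≤ δ) :
    1 + q⁻¹ ≤ (1 + q ^ (-(1 + δ))) * Real.exp (δ * (Real.log q / q)) := by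
  have hq0 : 0 < q := by linarith
  set y := q ^ (-(1 + δ)) with hy
  have hy0 : 0 < y := Real.rpow_pos_of_pos hq0 _
  have hdiff : q⁻¹ - y ≤ δ * (Real.log q / q) := by
    have h1 : y = q⁻¹ * Real.exp (-(δ * Real.log q)) := by
      rw [hy, neg_add, Real.rpow_add hq0, Real.rpow_neg_one, Real.rpow_def_of_pos hq0 (-δ)]
      ring_nf
    have h2 := Real.add_one_le_exp (-(δ * Real.log q))
    have h3 := mul_le_mul_of_nonneg_left h2 (inv_nonneg.2 hq0.le)
    rw [← h1] at h3
    calc q⁻¹ - y ≤ q⁻¹ - q⁻¹ * (-(δ * Real.log q) + 1) := by linarith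
      _ = δ * (Real.log q / q) := by field_simp; ring
  have hexp := Real.add_one_le_exp (δ * (Real.log q / q))
  have hnonneg : 0 ≤ δ * (Real.log q / q) :=
    mul_nonneg hδ (div_nonneg (Real.log_nonneg hq) hq0.le)
  nlinarith [mul_nonneg hy0.le hnonneg]

theorem NumberField.sum_log_absNorm_div_le_of_prod_le (hK : Module.finrank ℚ K = 2)
    (S : Finset (Ideal (𝓞 K))) (hS : ∀ P ∈ S, Prime P) {L : ℝ} (hL : 1 ≤ L)
    (hprod : ∑ P ∈ S, Real.log (Ideal.absNorm P) ≤ L) :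
    ∑ P ∈ S, Real.log (Ideal.absNorm P) / Ideal.absNorm P ≤ 4 * Real.log L + 1 := by
  classical
  have hL0 : 0 < L := by linarith
  have hlog (P : Ideal (𝓞 K)) : 0 ≤ Real.log (Ideal.absNorm P) := Real.log_natCast_nonneg _
  rw [← Finset.sum_filter_add_sum_filter_not S fun P ↦ (Ideal.absNorm P : ℝ) ≤ L]
  refine add_le_add ?_ ?_
  · have hfl : 1 ≤ ⌊L⌋₊ := Nat.le_floor (by exact_mod_cast hL)
    calc _ ≤ 4 * Real.log ⌊L⌋₊ := by
          refine sum_log_absNorm_div_le hK _ (fun P hP ↦ hS P (Finset.mem_filter.1 hP).1)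
            (by omega) fun P hP ↦ ?_
          exact Nat.le_floor (Finset.mem_filter.1 hP).2
      _ ≤ 4 * Real.log L := by
          gcongr
          exact Nat.floor_le hL0.le
  · calc _ ≤ ∑ P ∈ S with ¬ (Ideal.absNorm P : ℝ) ≤ L, Real.log (Ideal.absNorm P) / L := by
          refine Finset.sum_le_sum fun P hP ↦ ?_
          have := not_le.1 (Finset.mem_filter.1 hP).2
          exact div_le_div_of_nonneg_left (hlog P) hL0 this.le
      _ ≤ ∑ P ∈ S, Real.log (Ideal.absNorm P) / L :=
          Finset.sum_le_sum_of_subset_of_nonneg (Finset.filter_subset _ _)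
            fun P _ _ ↦ div_nonneg (hlog P) hL0.le
      _ ≤ 1 := by
          rw [← Finset.sum_div, div_le_one hL0]
          exact hprod

open UniqueFactorizationMonoid in
theorem NumberField.absNorm_le_mul_card_units_quotient (hK : Module.finrank ℚ K = 2)
    (hR : IsEmpty (K →+* ℝ)) {𝔞 : Ideal (𝓞 K)} (h𝔞 : 𝔞 ≠ ⊥)
    (hl : 1 ≤ Real.log (Real.log (Ideal.absNorm 𝔞))) :
    (Ideal.absNorm 𝔞 : ℝ) ≤ 576 * Real.exp 5 *
      (classNumber K * Real.log (Real.log (Ideal.absNorm 𝔞))) * Nat.card (𝓞 K ⧸ 𝔞)ˣ := by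
  classical
  set L := Real.log (Ideal.absNorm 𝔞) with hL
  set l := Real.log L with hldef
  set S := (factors 𝔞).toFinset with hSdef
  have hS : ∀ P ∈ S, Prime P := fun P hP ↦ prime_of_factor _ (Multiset.mem_toFinset.1 hP)
  have hN2 : ∀ P ∈ S, (2 : ℝ) ≤ Ideal.absNorm P := fun P hP ↦ by
    exact_mod_cast absNorm_prime_two_le (hS P hP)
  have hl0 : 0 < l := by linarith
  have hL0 : 0 ≤ L := Real.log_natCast_nonneg _
  have hL1 : 1 ≤ L := by
    by_contra! h
    linarith [Real.log_nonpos hL0 h.le]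
  have hsumlog : ∑ P ∈ S, Real.log (Ideal.absNorm P) ≤ L := by
    have hdvd : ∏ P ∈ S, P ^ 1 ∣ 𝔞 := Ideal.prod_pow_dvd_of_prime S hS (fun _ ↦ 1) fun P hP ↦ by
      rw [pow_one]
      exact dvd_of_mem_factors (Multiset.mem_toFinset.1 hP)
    have h := Nat.le_of_dvd (Nat.pos_of_ne_zero (Ideal.absNorm_eq_zero_iff.not.2 h𝔞))
      (map_dvd Ideal.absNorm hdvd)
    simp only [pow_one, map_prod] at h
    rw [← Real.log_prod fun P hP ↦ by linarith [hN2 P hP]]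
    refine Real.log_le_log (Finset.prod_pos fun P hP ↦ by linarith [hN2 P hP]) ?_
    exact_mod_cast h
  have hmertens := sum_log_absNorm_div_le_of_prod_le hK S hS hL1 hsumlog
  rw [← hldef] at hmertens
  set Q := ∏ P ∈ S, (1 - (Ideal.absNorm P : ℝ)⁻¹) with hQ
  have hfac : ∀ P ∈ S, 0 < 1 - (Ideal.absNorm P : ℝ)⁻¹ := fun P hP ↦
    sub_pos.2 (inv_lt_one_of_one_lt₀ (by linarith [hN2 P hP]))
  have hQ0 : 0 < Q := Finset.prod_pos hfac
  have hQinv : Q⁻¹ ≤ 4 * (classNumber K * (144 / l⁻¹) * Real.exp 5) := by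
    have hterm : ∀ P ∈ S, (1 - (Ideal.absNorm P : ℝ)⁻¹)⁻¹ =
        (Ideal.absNorm P : ℝ) ^ 2 / ((Ideal.absNorm P : ℝ) ^ 2 - 1) *
          (1 + (Ideal.absNorm P : ℝ)⁻¹) := fun P hP ↦ by
      have h2 := hN2 P hP
      generalize (Ideal.absNorm P : ℝ) = q at h2
      have h1 : q - 1 ≠ 0 := by linarith
      have h3 : q ^ 2 - 1 ≠ 0 := by nlinarith
      field_simp
      ring
    have hsq : ∀ P ∈ S, 0 ≤ (Ideal.absNorm P : ℝ) ^ 2 / ((Ideal.absNorm P : ℝ) ^ 2 - 1) :=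
      fun P hP ↦ div_nonneg (sq_nonneg _) (by nlinarith [hN2 P hP])
    rw [hQ, ← Finset.prod_inv_distrib, Finset.prod_congr rfl hterm, Finset.prod_mul_distrib]
    refine mul_le_mul (prod_absNorm_sq_div_le hK S hS) ?_
      (Finset.prod_nonneg fun P _ ↦ by positivity) (by norm_num)
    calc _ ≤ ∏ P ∈ S, ((1 + (Ideal.absNorm P : ℝ) ^ (-(1 + l⁻¹))) *
          Real.exp (l⁻¹ * (Real.log (Ideal.absNorm P) / Ideal.absNorm P))) :=
          Finset.prod_le_prod (fun P _ ↦ by positivity) fun P hP ↦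
            one_add_inv_le_mul_exp (by linarith [hN2 P hP]) (by positivity)
      _ = (∏ P ∈ S, (1 + (Ideal.absNorm P : ℝ) ^ (-(1 + l⁻¹)))) *
          Real.exp (l⁻¹ * ∑ P ∈ S, Real.log (Ideal.absNorm P) / Ideal.absNorm P) := by
          rw [Finset.prod_mul_distrib, ← Real.exp_sum, Finset.mul_sum]
      _ ≤ _ := by
          gcongr
          · exact prod_one_add_absNorm_rpow_le hK hR S hS (by positivity) (inv_le_one_of_one_le₀ hl)
          · rw [inv_mul_le_iff₀ hl0]
            linarith
  have hunits := Ideal.absNorm_mul_prod_le_card_units_quotient h𝔞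
  calc (Ideal.absNorm 𝔞 : ℝ) = Q⁻¹ * (Ideal.absNorm 𝔞 * Q) := by field_simp
    _ ≤ 4 * (classNumber K * (144 / l⁻¹) * Real.exp 5) * Nat.card (𝓞 K ⧸ 𝔞)ˣ := by gcongr
    _ = _ := by rw [div_inv_eq_mul]; ring

end ImaginaryQuadraticEuler

/-- There is a positive, effective absolute constant `C` such that for every
imaginary quadratic field `K` and every nonzero ideal `𝔞` of `O_K` with `|𝔞| ≥ 3`, one has
`φ_K(𝔞) ≥ (C / h_K) · |𝔞| / log log |𝔞|`.  Here `|𝔞| = #(O_K/𝔞)` is the norm of `𝔞`,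
`φ_K(𝔞) = #(O_K/𝔞)ˣ` and `h_K` is the class number of `K`. -/
theorem phiK_lower_bound :
    ∃ C : ℝ, 0 < C ∧
      ∀ (K : Type) [Field K] [NumberField K],
        Module.finrank ℚ K = 2 → IsEmpty (K →+* ℝ) →
        ∀ 𝔞 : Ideal (𝓞 K), 𝔞 ≠ ⊥ → 3 ≤ Ideal.absNorm 𝔞 →
          C / (NumberField.classNumber K) *
              ((Ideal.absNorm 𝔞 : ℝ) / Real.log (Real.log (Ideal.absNorm 𝔞))) ≤
            Nat.card ((𝓞 K ⧸ 𝔞)ˣ) := by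
  have hlog3 : 1 < Real.log 3 := by
    rw [Real.lt_log_iff_exp_lt (by norm_num)]
    linarith [Real.exp_one_lt_d9]
  have hll3 : 0 < Real.log (Real.log 3) := Real.log_pos hlog3
  refine ⟨min (Real.log (Real.log 3) / 27) (576 * Real.exp 5)⁻¹, by positivity, ?_⟩
  intro K _ _ hK hR 𝔞 h𝔞 h3
  have hN3 : (3 : ℝ) ≤ Ideal.absNorm 𝔞 := by exact_mod_cast h3
  have hh : (1 : ℝ) ≤ classNumber K := by exact_mod_cast classNumber_pos K
  have hfin : Finite (𝓞 K ⧸ 𝔞) := (Ideal.absNorm_ne_zero_iff 𝔞).1 (by omega)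
  have hcard : (1 : ℝ) ≤ Nat.card (𝓞 K ⧸ 𝔞)ˣ := by exact_mod_cast Nat.card_pos
  have hll : Real.log (Real.log 3) ≤ Real.log (Real.log (Ideal.absNorm 𝔞)) :=
    Real.log_le_log (by linarith) (Real.log_le_log (by norm_num) hN3)
  have hll0 : 0 < Real.log (Real.log (Ideal.absNorm 𝔞)) := hll3.trans_le hll
  rw [div_mul_div_comm, div_le_iff₀ (by positivity)]
  rcases le_total 1 (Real.log (Real.log (Ideal.absNorm 𝔞))) with hl | hl
  · have h := absNorm_le_mul_card_units_quotient hK hR h𝔞 hl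
    calc _ ≤ (576 * Real.exp 5)⁻¹ * (Ideal.absNorm 𝔞 : ℝ) := by
          gcongr
          exact min_le_right _ _
      _ ≤ _ := by
          rw [inv_mul_le_iff₀ (by positivity)]
          linarith
  · have hN : (Ideal.absNorm 𝔞 : ℝ) ≤ 27 := by
      have hlog : 0 < Real.log (Ideal.absNorm 𝔞) := Real.log_pos (by linarith)
      rw [Real.log_le_iff_le_exp hlog] at hl
      have hlog' : Real.log (Ideal.absNorm 𝔞) ≤ (3 : ℕ) * Real.log 3 := by
        push_cast
        linarith [Real.exp_one_lt_d9]
      rw [← Real.log_pow, Real.log_le_log_iff (by linarith) (by norm_num)] at hlog'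
      linarith
    calc _ ≤ Real.log (Real.log 3) / 27 * 27 := by
          gcongr
          exact min_le_left _ _
      _ = 1 * Real.log (Real.log 3) * 1 := by ring
      _ ≤ (classNumber K : ℝ) * Real.log (Real.log (Ideal.absNorm 𝔞)) *
          Nat.card (𝓞 K ⧸ 𝔞)ˣ := by gcongr
      _ = _ := by ring
end

section
/- There is an effective absolute constant C > 0 such that for every fundamental quadratic discriminant Δ < 0, with K = ℚ(√Δ), h_K the class number of K, and χ = (Δ/·) the Kronecker symbol, one has ∏_{p ≤ x, p prime} (1 − χ(p)/p) ≥ C / h_K for all real x ≥ 2. -/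
/-- The Kronecker symbol `(Δ/p)` at a prime `p` (agreeing with the Legendre/Jacobi symbol at
odd primes, with the usual convention at `p = 2`). -/
def kroneckerAtPrime (Δ : ℤ) (p : ℕ) : ℤ :=
  if p = 2 then (if Δ % 2 = 0 then 0 else if Δ % 8 = 1 ∨ Δ % 8 = 7 then 1 else -1)
  else jacobiSym Δ p

/-- `Δ` is a fundamental quadratic discriminant: either `Δ ≡ 1 (mod 4)` and squarefree,
or `Δ = 4m` with `m ≡ 2, 3 (mod 4)` squarefree. -/
def IsFundamentalDiscriminant (Δ : ℤ) : Prop :=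
  (Δ % 4 = 1 ∧ Squarefree Δ) ∨
    (Δ % 4 = 0 ∧ Squarefree (Δ / 4) ∧ ((Δ / 4) % 4 = 2 ∨ (Δ / 4) % 4 = 3))

theorem prod_primesLE_pow_div_dvd_factorial (n : ℕ) :
    ∏ p ∈ n.primesLE, p ^ (n / p) ∣ n.factorial := by
  refine Finset.prod_dvd_of_isRelPrime (fun p hp q hq hpq => ?_) fun p hp => ?_
  · have hp' := (Nat.mem_primesLE.mp hp).2
    have hq' := (Nat.mem_primesLE.mp hq).2
    exact Nat.coprime_iff_isRelPrime.mp
      (Nat.Coprime.pow _ _ ((Nat.coprime_primes hp' hq').mpr hpq))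
  · obtain ⟨hpn, hp'⟩ := Nat.mem_primesLE.mp hp
    rw [hp'.pow_dvd_factorial_iff (Nat.lt_succ_self _)]
    have h1 : 1 ∈ Finset.Ico 1 (Nat.log p n).succ :=
      Finset.mem_Ico.mpr ⟨le_rfl, Nat.succ_lt_succ (Nat.log_pos hp'.one_lt hpn)⟩
    simpa using Finset.single_le_sum (f := fun i => n / p ^ i) (fun _ _ => Nat.zero_le _) h1

theorem sum_primesLE_log_div_le {n : ℕ} (hn : n ≠ 0) :
    ∑ p ∈ n.primesLE, Real.log p / p ≤ Real.log n + Real.log 4 := by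
  have hn0 : (0 : ℝ) < n := by positivity
  have h1 : ∑ p ∈ n.primesLE, ((n / p : ℕ) : ℝ) * Real.log p ≤ n * Real.log n := by
    have h := Nat.le_trans
      (Nat.le_of_dvd n.factorial_pos (prod_primesLE_pow_div_dvd_factorial n))
      (Nat.factorial_le_pow n)
    have h' : ((∏ p ∈ n.primesLE, p ^ (n / p) : ℕ) : ℝ) ≤ (n : ℝ) ^ n := by exact_mod_cast h
    have hpos : (0 : ℝ) < ((∏ p ∈ n.primesLE, p ^ (n / p) : ℕ) : ℝ) := by
      exact_mod_cast Finset.prod_pos fun p hp => pow_pos (Nat.mem_primesLE.mp hp).2.pos _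
    have h'' := Real.log_le_log hpos h'
    rw [Real.log_pow, Nat.cast_prod, Real.log_prod] at h''
    · simpa [Real.log_pow] using h''
    · intro p hp
      have := (Nat.mem_primesLE.mp hp).2.ne_zero
      positivity
  have h2 : ∑ p ∈ n.primesLE, Real.log p ≤ Real.log 4 * n := by
    rw [← Chebyshev.theta_eq_sum_primesLE_log]
    exact Chebyshev.theta_le_log4_mul_x hn0.le
  have h3 : n * ∑ p ∈ n.primesLE, Real.log p / p ≤
      ∑ p ∈ n.primesLE, ((n / p : ℕ) : ℝ) * Real.log p + ∑ p ∈ n.primesLE, Real.log p := by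
    rw [Finset.mul_sum, ← Finset.sum_add_distrib]
    refine Finset.sum_le_sum fun p hp => ?_
    have hp' := (Nat.mem_primesLE.mp hp).2
    have hlog : 0 ≤ Real.log p := Real.log_natCast_nonneg p
    have hfl : (n : ℝ) / p ≤ ((n / p : ℕ) : ℝ) + 1 := by
      rw [← Nat.floor_div_eq_div (K := ℝ)]
      exact (Nat.lt_floor_add_one _).le
    calc n * (Real.log p / p) = (n : ℝ) / p * Real.log p := by ring
      _ ≤ (((n / p : ℕ) : ℝ) + 1) * Real.log p := by gcongr
      _ = _ := by ring
  refine le_of_mul_le_mul_left ?_ hn0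
  linarith

theorem log_le_prod_primesLE_inv (n : ℕ) :
    Real.log n ≤ ∏ p ∈ n.primesLE, (1 - (p : ℝ)⁻¹)⁻¹ := by
  let f : ℕ →* ℝ :=
    { toFun := fun m => (m : ℝ)⁻¹, map_one' := by simp, map_mul' := by intros; simp [mul_comm] }
  obtain ⟨hs, hsum⟩ := EulerProduct.summable_and_hasSum_smoothNumbers_prod_primesBelow_geometric
    (f := f) (fun {p} hp => by
      have : (1 : ℝ) < p := by exact_mod_cast hp.one_lt
      simpa [f] using inv_lt_one_of_one_lt₀ this) (n + 1)
  have hlog : Real.log n ≤ (harmonic n : ℝ) :=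
    le_trans (by
      rcases n.eq_zero_or_pos with rfl | hn
      · simp
      · exact Real.log_le_log (by exact_mod_cast hn) (by push_cast; linarith))
      (log_add_one_le_harmonic n)
  refine hlog.trans ?_
  have hmem : ∀ m : Finset.range n, (m : ℕ) + 1 ∈ (n + 1).smoothNumbers := fun m =>
    Nat.mem_smoothNumbers_of_lt (Nat.succ_pos _)
      (Nat.succ_lt_succ (Finset.mem_range.mp m.2))
  let g : Finset.range n ↪ (n + 1).smoothNumbers :=
    ⟨fun m => ⟨m + 1, hmem m⟩, fun a b hab => by
      have := congrArg Subtype.val hab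
      exact Subtype.ext (Nat.succ_injective this)⟩
  have h := sum_le_hasSum (Finset.univ.map g) (fun i _ => by
    change (0 : ℝ) ≤ ((i : ℕ) : ℝ)⁻¹
    positivity) hsum
  rw [Finset.sum_map] at h
  have heq : (harmonic n : ℝ) = ∑ m : Finset.range n, f (g m) := by
    rw [harmonic, Rat.cast_sum, ← Finset.sum_attach]
    refine Finset.sum_congr (Finset.univ_eq_attach _).symm fun m _ => ?_
    change (((((m : ℕ) + 1 : ℕ) : ℚ)⁻¹ : ℚ) : ℝ) = (((m : ℕ) + 1 : ℕ) : ℝ)⁻¹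
    push_cast
    rfl
  rw [heq]
  exact h

theorem sum_Icc_rpow_neg_le {δ : ℝ} (hδ : 0 < δ) (n : ℕ) :
    ∑ m ∈ Finset.Icc 1 n, (m : ℝ) ^ (-(1 + δ)) ≤ 1 + 1 / δ := by
  suffices h : ∀ n : ℕ, ∑ m ∈ Finset.Icc 1 (n + 1), (m : ℝ) ^ (-(1 + δ)) ≤
      1 + 1 / δ * (1 - ((n + 1 : ℕ) : ℝ) ^ (-δ)) by
    rcases n with _ | n
    · simp; positivity
    · refine (h n).trans ?_
      have : (0 : ℝ) ≤ ((n + 1 : ℕ) : ℝ) ^ (-δ) := by positivity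
      gcongr
      exact mul_le_of_le_one_right (by positivity) (by linarith)
  intro n
  induction n with
  | zero => simp
  | succ n ih =>
    rw [Finset.sum_Icc_succ_top (by omega)]
    set m : ℝ := ((n + 1 + 1 : ℕ) : ℝ) with hm
    have hm1 : ((n + 1 : ℕ) : ℝ) = m - 1 := by rw [hm]; push_cast; ring
    have hm2 : 2 ≤ m := by rw [hm]; push_cast; linarith [(Nat.cast_nonneg n : (0 : ℝ) ≤ n)]
    rw [hm1] at ih
    have key : m ^ (-(1 + δ)) ≤ 1 / δ * ((m - 1) ^ (-δ) - m ^ (-δ)) := by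
      have hlog : Real.log ((m - 1) / m) ≤ -(1 / m) := by
        have := Real.log_le_sub_one_of_pos (x := (m - 1) / m) (by apply div_pos <;> linarith)
        have e : (m - 1) / m - 1 = -(1 / m) := by field_simp; ring
        linarith
      have h1 : 1 + δ / m ≤ ((m - 1) / m) ^ (-δ) := by
        rw [Real.rpow_def_of_pos (by apply div_pos <;> linarith)]
        have := Real.add_one_le_exp (Real.log ((m - 1) / m) * -δ)
        have h2 : δ * Real.log ((m - 1) / m) ≤ δ * (-(1 / m)) := by gcongr
        have h3 : δ * (-(1 / m)) = -(δ / m) := by ring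
        linarith
      have h2 : (m - 1) ^ (-δ) = m ^ (-δ) * ((m - 1) / m) ^ (-δ) := by
        rw [← Real.mul_rpow (by linarith) (by apply div_nonneg <;> linarith)]
        congr 1
        field_simp
      have h3 : m ^ (-(1 + δ)) = m ^ (-δ) * (1 / m) := by
        rw [neg_add, add_comm, Real.rpow_add (by linarith), Real.rpow_neg_one, one_div]
      have h4 : 0 ≤ m ^ (-δ) := by positivity
      rw [h2, h3]
      calc m ^ (-δ) * (1 / m) = 1 / δ * (m ^ (-δ) * (δ / m)) := by field_simp
        _ ≤ 1 / δ * (m ^ (-δ) * (((m - 1) / m) ^ (-δ) - 1)) := by gcongr; linarith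
        _ = _ := by ring
    calc _ ≤ 1 + 1 / δ * (1 - (m - 1) ^ (-δ)) + 1 / δ * ((m - 1) ^ (-δ) - m ^ (-δ)) :=
          add_le_add ih key
      _ = _ := by ring

/-- Partial summation: a family with at most `c * m` members of size at most `m`, for every `m`,
is dominated by `c` copies of the positive integers when summed against a decreasing weight. -/
theorem sum_antitone_le_of_card_le {ι : Type*} (T : Finset ι) (N : ι → ℕ) (f : ℕ → ℝ) {c : ℝ}
    (hf : AntitoneOn f (Set.Ici 1)) (hf0 : ∀ n, 0 ≤ f n) (hN : ∀ i ∈ T, 1 ≤ N i)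
    (hc : ∀ m : ℕ, ((T.filter fun i => N i ≤ m).card : ℝ) ≤ c * m) {M : ℕ}
    (hM : ∀ i ∈ T, N i ≤ M) :
    ∑ i ∈ T, f (N i) ≤ c * ∑ m ∈ Finset.Icc 1 M, f m := by
  have h1 : ∀ i ∈ T, f (N i) = f (M + 1) +
      ∑ m ∈ (Finset.Icc 1 M).filter (fun m => N i ≤ m), (f m - f (m + 1)) := by
    intro i hi
    have e : (Finset.Icc 1 M).filter (fun m => N i ≤ m) = Finset.Ico (N i) (M + 1) := by
      ext m
      have := hN i hi
      simp only [Finset.mem_filter, Finset.mem_Icc, Finset.mem_Ico]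
      omega
    have := Finset.sum_Ico_sub f (Nat.le_succ_of_le (hM i hi))
    rw [e]
    have h2 : ∑ m ∈ Finset.Ico (N i) (M + 1), (f m - f (m + 1)) =
        -∑ m ∈ Finset.Ico (N i) (M + 1), (f (m + 1) - f m) := by
      rw [← Finset.sum_neg_distrib]; simp
    rw [h2, this]
    simp
  have habel : ∀ M : ℕ, (M : ℝ) * f (M + 1) + ∑ m ∈ Finset.Icc 1 M, (m : ℝ) * (f m - f (m + 1)) =
      ∑ m ∈ Finset.Icc 1 M, f m := by
    intro M
    induction M with
    | zero => simp
    | succ M ih =>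
      rw [Finset.sum_Icc_succ_top (by omega), Finset.sum_Icc_succ_top (by omega), ← ih]
      push_cast
      ring
  have hT : (T.card : ℝ) ≤ c * M := by
    have := hc M
    rwa [Finset.filter_true_of_mem hM] at this
  rw [Finset.sum_congr rfl h1, Finset.sum_add_distrib, Finset.sum_const, nsmul_eq_mul]
  have hswap : ∑ i ∈ T, ∑ m ∈ (Finset.Icc 1 M).filter (fun m => N i ≤ m), (f m - f (m + 1)) =
      ∑ m ∈ Finset.Icc 1 M, ((T.filter fun i => N i ≤ m).card : ℝ) * (f m - f (m + 1)) := by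
    rw [Finset.sum_comm' (t' := Finset.Icc 1 M) (s' := fun m => T.filter fun i => N i ≤ m)]
    · simp only [Finset.sum_const, nsmul_eq_mul]
    · intro i m
      simp only [Finset.mem_filter]
      tauto
  rw [hswap, ← habel M, mul_add, Finset.mul_sum]
  refine add_le_add ?_ (Finset.sum_le_sum fun m hm => ?_)
  · calc (T.card : ℝ) * f (M + 1) ≤ c * M * f (M + 1) := by gcongr; exact hf0 _
      _ = _ := by ring
  · have hm1 := (Finset.mem_Icc.mp hm).1
    have : 0 ≤ f m - f (m + 1) :=
      sub_nonneg.mpr (hf hm1 (Set.mem_Ici.mpr (by omega)) (Nat.le_succ m))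
    calc _ ≤ c * m * (f m - f (m + 1)) := by gcongr; exact hc m
      _ = _ := by ring

theorem sum_rpow_neg_le_of_card_le {ι : Type*} (T : Finset ι) (N : ι → ℕ) {c δ : ℝ} (hδ : 0 < δ)
    (hc0 : 0 ≤ c) (hN : ∀ i ∈ T, 1 ≤ N i)
    (hc : ∀ m : ℕ, ((T.filter fun i => N i ≤ m).card : ℝ) ≤ c * m) :
    ∑ i ∈ T, (N i : ℝ) ^ (-(1 + δ)) ≤ c * (1 + 1 / δ) := by
  refine (sum_antitone_le_of_card_le T N (fun n => (n : ℝ) ^ (-(1 + δ))) ?_ ?_ hN hc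
    (M := T.sup N) fun i hi => Finset.le_sup hi).trans ?_
  · intro a ha b _ hab
    have ha' : (0 : ℝ) < a := by exact_mod_cast (Set.mem_Ici.mp ha)
    exact Real.rpow_le_rpow_of_nonpos ha' (by exact_mod_cast hab) (by linarith)
  · intro n; positivity
  · exact mul_le_mul_of_nonneg_left (sum_Icc_rpow_neg_le hδ _) hc0

/-- Moving the exponent of an Euler factor from `1 + δ` down to `1`. -/
theorem one_sub_rpow_neg_le {p δ : ℝ} (hp : 2 ≤ p) (hδ : 0 ≤ δ) :
    1 - p ^ (-(1 + δ)) ≤ (1 - p⁻¹) * Real.exp (2 * δ * (Real.log p / p)) := by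
  have hp0 : 0 < p := by linarith
  have h1 : p ^ (-(1 + δ)) = p⁻¹ * Real.exp (-(δ * Real.log p)) := by
    rw [neg_add, Real.rpow_add hp0, Real.rpow_neg_one, Real.rpow_def_of_pos hp0]
    congr 2
    ring
  have h2 := Real.add_one_le_exp (-(δ * Real.log p))
  have h3 := Real.add_one_le_exp (2 * δ * (Real.log p / p))
  have hinv : p⁻¹ ≤ 1 / 2 := by
    rw [one_div]; exact inv_anti₀ (by norm_num) hp
  have hinv0 : 0 < p⁻¹ := by positivity
  have hl : 0 ≤ δ * Real.log p := mul_nonneg hδ (Real.log_nonneg (by linarith))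
  rw [h1]
  calc 1 - p⁻¹ * Real.exp (-(δ * Real.log p)) ≤ 1 - p⁻¹ * (-(δ * Real.log p) + 1) := by gcongr
    _ = (1 - p⁻¹) + (1 / 2) * (2 * (p⁻¹ * (δ * Real.log p))) := by ring
    _ ≤ (1 - p⁻¹) + (1 - p⁻¹) * (2 * (p⁻¹ * (δ * Real.log p))) := by gcongr; linarith
    _ = (1 - p⁻¹) * (2 * δ * (Real.log p / p) + 1) := by ring
    _ ≤ _ := by gcongr; linarith

theorem exists_finset_ideal_prod_geom_sum_eq {R : Type*} [CommRing R] [IsDedekindDomain R]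
    (w : Ideal R →* ℝ) (S : Finset (Ideal R)) (hS : ∀ P ∈ S, Prime P) (B : ℕ) :
    ∃ T : Finset (Ideal R), (∀ I ∈ T, I ≠ 0) ∧
      ∏ P ∈ S, ∑ k ∈ Finset.range B, w P ^ k = ∑ I ∈ T, w I := by
  classical
  let M : (S → ℕ) → Multiset (Ideal R) := fun e => ∑ P : S, e P • {(P : Ideal R)}
  have hM : ∀ e, ∀ P ∈ M e, Prime P := by
    intro e P hP
    obtain ⟨Q, -, hQ⟩ := Multiset.mem_sum.mp hP
    have := Multiset.mem_singleton.mp (Multiset.mem_of_mem_nsmul hQ)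
    exact this ▸ hS _ Q.2
  have hprod : ∀ e, (M e).prod = ∏ P : S, (P : Ideal R) ^ e P := by
    intro e
    simp [M, Multiset.prod_sum, Multiset.prod_nsmul]
  have hinj : Function.Injective fun e : S → ℕ => ∏ P : S, (P : Ideal R) ^ e P := by
    intro e e' h
    have h' : M e = M e' := by
      rw [← UniqueFactorizationMonoid.normalizedFactors_prod_of_prime (hM e),
        ← UniqueFactorizationMonoid.normalizedFactors_prod_of_prime (hM e'), hprod, hprod]
      exact congrArg _ h
    have hcount : ∀ (e : S → ℕ) (P : S), (M e).count (P : Ideal R) = e P := by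
      intro e P
      simp [M, Multiset.count_sum', Multiset.count_nsmul, Multiset.count_singleton]
    ext P
    rw [← hcount e, ← hcount e', h']
  refine ⟨(Fintype.piFinset fun _ : S => Finset.range B).image
    (fun e : S → ℕ => ∏ P : S, (P : Ideal R) ^ e P), ?_, ?_⟩
  · intro I hI
    obtain ⟨e, -, rfl⟩ := Finset.mem_image.mp hI
    exact Finset.prod_ne_zero_iff.mpr fun P _ => pow_ne_zero _ (hS _ P.2).ne_zero
  · rw [Finset.sum_image hinj.injOn, ← Finset.prod_attach, ← Finset.univ_eq_attach,
      Finset.prod_univ_sum]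
    simp [map_prod]

section ImaginaryQuadratic

open NumberField

variable {K : Type*} [Field K] [NumberField K]

theorem exists_embedding_sq_norm_eq_abs_norm (hK : Module.finrank ℚ K = 2) {α : K} {Δ : ℤ}
    (hΔ : Δ < 0) (hα : α ^ 2 = (Δ : K)) :
    ∃ φ : K →+* ℂ, (φ α).re = 0 ∧ ∀ x, ‖φ x‖ ^ 2 = |((Algebra.norm ℚ x : ℚ) : ℝ)| := by
  have hre : ∀ φ : K →+* ℂ, (φ α).re = 0 ∧ (φ α).im ≠ 0 := by
    intro φ
    have h : (φ α) ^ 2 = (Δ : ℂ) := by rw [← map_pow, hα, map_intCast]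
    have h1 := congrArg Complex.re h
    have h2 := congrArg Complex.im h
    simp [pow_two] at h1 h2
    have h3 : ((Δ : ℤ) : ℝ) < 0 := by exact_mod_cast hΔ
    have him : (φ α).im ≠ 0 := fun h0 => by
      rw [h0] at h1
      nlinarith [mul_self_nonneg (φ α).re]
    refine ⟨?_, him⟩
    have h4 : (φ α).re * (φ α).im = 0 := by linarith
    exact (mul_eq_zero.mp h4).resolve_right him
  have hC : IsTotallyComplex K := by
    refine ⟨fun v => ?_⟩
    rw [← InfinitePlace.not_isReal_iff_isComplex]
    intro hv
    have h := (hre v.embedding).2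
    have := InfinitePlace.isReal_iff.mp hv
    exact h (by
      have := congrArg Complex.im (RingHom.congr_fun (ComplexEmbedding.isReal_iff.mp this) α)
      simp at this
      linarith)
  have hcard : Fintype.card (InfinitePlace K) = 1 := by
    have h1 := IsTotallyComplex.finrank K
    have h2 := InfinitePlace.card_eq_nrRealPlaces_add_nrComplexPlaces K
    rw [IsTotallyComplex.nrRealPlaces_eq_zero] at h2
    omega
  obtain ⟨w, hw⟩ := Fintype.card_eq_one_iff.mp hcard
  refine ⟨w.embedding, (hre _).1, fun x => ?_⟩
  have h := InfinitePlace.prod_eq_abs_norm x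
  rw [Finset.prod_eq_single_of_mem w (Finset.mem_univ _) fun b _ hb => absurd (hw b) hb,
    IsTotallyComplex.mult_eq, Rat.cast_abs] at h
  rw [← h, InfinitePlace.norm_embedding_eq]

theorem sq_norm_eq_absNorm_span {φ : K →+* ℂ}
    (hφ : ∀ x, ‖φ x‖ ^ 2 = |((Algebra.norm ℚ x : ℚ) : ℝ)|) (a : 𝓞 K) :
    ‖φ a‖ ^ 2 = (Ideal.absNorm (Ideal.span {a}) : ℝ) := by
  rw [hφ, Ideal.absNorm_span_singleton, ← Algebra.coe_norm_int, Nat.cast_natAbs]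
  push_cast
  rfl

theorem card_ideals_in_class_le {φ : K →+* ℂ}
    (hφ : ∀ x, ‖φ x‖ ^ 2 = |((Algebra.norm ℚ x : ℚ) : ℝ)|)
    (C : ClassGroup (𝓞 K))
    (T : Finset (nonZeroDivisors (Ideal (𝓞 K)))) (m : ℕ)
    (hT : ∀ I ∈ T, ClassGroup.mk0 I = C ∧ Ideal.absNorm (I : Ideal (𝓞 K)) ≤ m) :
    (T.card : ℝ) ≤ 64 * m := by
  classical
  rcases T.eq_empty_or_nonempty with rfl | ⟨I₀, hI₀⟩
  · simp
  have hm1 : 1 ≤ m := (Ideal.absNorm_pos_of_nonZeroDivisors I₀).trans_le (hT I₀ hI₀).2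
  obtain ⟨J, hJ⟩ := ClassGroup.mk0_surjective C⁻¹
  have hex : ∀ I : nonZeroDivisors (Ideal (𝓞 K)), ∃ a : 𝓞 K, I ∈ T →
      (I : Ideal (𝓞 K)) * J = Ideal.span {a} := by
    intro I
    by_cases hI : I ∈ T
    · have h : ClassGroup.mk0 I = (ClassGroup.mk0 J)⁻¹ := by rw [(hT I hI).1, hJ, inv_inv]
      obtain ⟨a, -, ha⟩ := ClassGroup.mk0_eq_mk0_inv_iff.mp h
      exact ⟨a, fun _ => ha⟩
    · exact ⟨0, fun h => absurd h hI⟩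
  choose a ha using hex
  set b : ℝ := (Ideal.absNorm (J : Ideal (𝓞 K)) : ℝ) with hb
  have hb0 : 0 < b := Nat.cast_pos.mpr <| Ideal.absNorm_pos_of_nonZeroDivisors J
  set r : ℝ := √b with hr
  have hr0 : 0 < r := Real.sqrt_pos.mpr hb0
  have hr2 : r ^ 2 = b := Real.sq_sqrt hb0.le
  let g : nonZeroDivisors (Ideal (𝓞 K)) → ℤ × ℤ := fun I =>
    (⌊2 * (φ (a I)).re / r⌋, ⌊2 * (φ (a I)).im / r⌋)
  set s : ℕ := Nat.sqrt m + 1 with hs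
  have hsm : (m : ℝ) < (s : ℝ) ^ 2 := by
    have := Nat.lt_succ_sqrt m
    rw [← Nat.succ_eq_add_one] at hs
    rw [pow_two]
    exact_mod_cast hs ▸ this
  have hmaps : ∀ I ∈ T, g I ∈
      Finset.Ico (-(2 * s : ℤ)) (2 * s) ×ˢ Finset.Ico (-(2 * s : ℤ)) (2 * s) := by
    intro I hI
    have hn : ‖φ (a I)‖ ^ 2 ≤ m * b := by
      rw [sq_norm_eq_absNorm_span hφ, ← ha I hI, map_mul, Nat.cast_mul]
      gcongr
      exact (hT I hI).2
    have hn' : ‖φ (a I)‖ < s * r := by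
      refine lt_of_pow_lt_pow_left₀ 2 (by positivity) ?_
      rw [mul_pow, hr2]
      exact hn.trans_lt (by gcongr)
    have hfl : ∀ x : ℝ, |x| ≤ ‖φ (a I)‖ → ⌊2 * x / r⌋ ∈ Finset.Ico (-(2 * s : ℤ)) (2 * s) := by
      intro x hx
      have hx' := abs_lt.mp (hx.trans_lt hn')
      rw [Finset.mem_Ico]
      constructor
      · rw [Int.le_floor, le_div_iff₀ hr0]
        push_cast
        linarith [hx'.1]
      · rw [Int.floor_lt, div_lt_iff₀ hr0]
        push_cast
        linarith [hx'.2]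
    exact Finset.mem_product.mpr
      ⟨hfl _ (Complex.abs_re_le_norm _), hfl _ (Complex.abs_im_le_norm _)⟩
  have hinj : Set.InjOn g T := by
    intro I hI I' hI' h
    have hfl : ∀ x y : ℝ, ⌊2 * x / r⌋ = ⌊2 * y / r⌋ → (x - y) ^ 2 ≤ b / 4 := by
      intro x y hxy
      have h1 := abs_lt.mp (Int.abs_sub_lt_one_of_floor_eq_floor hxy)
      have h2 : 2 * x / r - 2 * y / r = 2 * (x - y) / r := by ring
      rw [h2, lt_div_iff₀ hr0, div_lt_iff₀ hr0] at h1
      rw [← hr2]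
      nlinarith [h1.1, h1.2]
    have h1 := hfl _ _ (congrArg Prod.fst h)
    have h2 := hfl _ _ (congrArg Prod.snd h)
    have hd : ‖φ ((a I - a I' : 𝓞 K) : K)‖ ^ 2 < b := by
      have hsub : ((a I - a I' : 𝓞 K) : K) = a I - a I' := map_sub (algebraMap (𝓞 K) K) _ _
      rw [← Complex.normSq_eq_norm_sq, Complex.normSq_apply, hsub, map_sub, Complex.sub_re,
        Complex.sub_im]
      linarith
    have haJ : ∀ L ∈ T, a L ∈ (J : Ideal (𝓞 K)) := fun L hL =>
      Ideal.dvd_span_singleton.mp (Dvd.intro_left _ (ha L hL))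
    have heq : a I = a I' := by
      by_contra hne
      have hsub : a I - a I' ∈ (J : Ideal (𝓞 K)) := sub_mem (haJ I hI) (haJ I' hI')
      have hdvd := Ideal.absNorm_dvd_absNorm_of_le
        ((Ideal.span_singleton_le_iff_mem _).mpr hsub)
      rw [sq_norm_eq_absNorm_span hφ] at hd
      have hpos : 0 < Ideal.absNorm (Ideal.span {a I - a I'}) := by
        rw [Nat.pos_iff_ne_zero, Ne, Ideal.absNorm_eq_zero_iff, Ideal.span_singleton_eq_bot]
        exact sub_ne_zero.mpr hne
      have := Nat.le_of_dvd hpos hdvd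
      exact absurd hd (not_lt.mpr (by rw [hb]; exact_mod_cast this))
    have hmul : (I : Ideal (𝓞 K)) * J = I' * J := by rw [ha I hI, ha I' hI', heq]
    exact Subtype.ext (mul_right_cancel₀ (nonZeroDivisors.coe_ne_zero J) hmul)
  have hcard := Finset.card_le_card_of_injOn g hmaps hinj
  rw [Finset.card_product, Int.card_Ico] at hcard
  have h4 : (2 * s - -(2 * s) : ℤ).toNat = 4 * s := by omega
  rw [h4] at hcard
  have hs2 : s ^ 2 ≤ 4 * m := by
    have h1 := Nat.sqrt_le m
    have h2 : 1 ≤ Nat.sqrt m := Nat.le_sqrt.mpr (by omega)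
    nlinarith
  have : T.card ≤ 64 * m := by nlinarith
  exact_mod_cast this

theorem card_ideals_absNorm_le {φ : K →+* ℂ}
    (hφ : ∀ x, ‖φ x‖ ^ 2 = |((Algebra.norm ℚ x : ℚ) : ℝ)|)
    (T : Finset (Ideal (𝓞 K))) (hT : ∀ I ∈ T, I ≠ 0) (m : ℕ)
    (hm : ∀ I ∈ T, Ideal.absNorm I ≤ m) :
    (T.card : ℝ) ≤ 64 * classNumber K * m := by
  classical
  let T' : Finset (nonZeroDivisors (Ideal (𝓞 K))) :=
    T.attach.image fun I : T =>
      ⟨(I : Ideal (𝓞 K)), mem_nonZeroDivisors_of_ne_zero (hT _ I.2)⟩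
  have hT' : T'.card = T.card := by
    rw [Finset.card_image_of_injective, Finset.card_attach]
    intro I I' h
    exact Subtype.ext (congrArg (fun L : nonZeroDivisors (Ideal (𝓞 K)) => (L : Ideal (𝓞 K))) h)
  rw [← hT', Finset.card_eq_sum_card_fiberwise (f := ClassGroup.mk0) (t := Finset.univ)
    (fun _ _ => Finset.mem_coe.mpr (Finset.mem_univ _)), Nat.cast_sum]
  refine (Finset.sum_le_card_nsmul _ _ (64 * (m : ℝ)) fun C _ => ?_).trans (le_of_eq ?_)
  · refine card_ideals_in_class_le hφ C _ m fun I hI => ?_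
    obtain ⟨hI, hIC⟩ := Finset.mem_filter.mp hI
    obtain ⟨L, -, rfl⟩ := Finset.mem_image.mp hI
    exact ⟨hIC, hm _ L.2⟩
  · rw [Finset.card_univ, nsmul_eq_mul, classNumber]
    ring

/-- A finite piece of the Euler product of the Dedekind zeta function of an imaginary quadratic
field, bounded in terms of the class number. -/
theorem prod_one_sub_absNorm_rpow_neg_inv_le {φ : K →+* ℂ}
    (hφ : ∀ x, ‖φ x‖ ^ 2 = |((Algebra.norm ℚ x : ℚ) : ℝ)|)
    (S : Finset (Ideal (𝓞 K))) (hS : ∀ P ∈ S, Prime P)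
    {δ : ℝ} (hδ : 0 < δ) :
    ∏ P ∈ S, (1 - (Ideal.absNorm P : ℝ) ^ (-(1 + δ)))⁻¹ ≤ 64 * classNumber K * (1 + 1 / δ) := by
  let w : Ideal (𝓞 K) →* ℝ :=
    { toFun := fun I => (Ideal.absNorm I : ℝ) ^ (-(1 + δ))
      map_one' := by simp
      map_mul' := fun I I' => by
        rw [map_mul, Nat.cast_mul, Real.mul_rpow (Nat.cast_nonneg _) (Nat.cast_nonneg _)] }
  have hlim : Filter.Tendsto (fun B : ℕ => ∏ P ∈ S, ∑ k ∈ Finset.range B, w P ^ k) Filter.atTop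
      (nhds (∏ P ∈ S, (1 - w P)⁻¹)) := by
    refine tendsto_finsetProd _ fun P hP => ?_
    refine (hasSum_geometric_of_lt_one (Real.rpow_nonneg (Nat.cast_nonneg _) _) ?_).tendsto_sum_nat
    have h0 : Ideal.absNorm P ≠ 0 := by
      rw [Ne, Ideal.absNorm_eq_zero_iff]; exact (hS P hP).ne_zero
    have h1 : Ideal.absNorm P ≠ 1 := by
      rw [Ne, Ideal.absNorm_eq_one_iff, ← Ideal.isUnit_iff]; exact (hS P hP).not_isUnit
    have h2 : (1 : ℝ) < Ideal.absNorm P := by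
      exact_mod_cast (by omega : 1 < Ideal.absNorm P)
    exact Real.rpow_lt_one_of_one_lt_of_neg h2 (by linarith)
  refine le_of_tendsto' hlim fun B => ?_
  obtain ⟨T, hT, h⟩ := exists_finset_ideal_prod_geom_sum_eq w S hS B
  rw [h]
  refine sum_rpow_neg_le_of_card_le T (fun I => Ideal.absNorm I) hδ (by positivity) ?_ ?_
  · intro I hI
    rw [Nat.one_le_iff_ne_zero, Ne, Ideal.absNorm_eq_zero_iff]
    exact hT I hI
  · intro m
    exact card_ideals_absNorm_le hφ _ (fun I hI => hT I (Finset.mem_filter.mp hI).1) m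
      fun I hI => (Finset.mem_filter.mp hI).2

end ImaginaryQuadratic

section PrimeSplitting

open NumberField

variable {K : Type*} [Field K] [NumberField K]

theorem int_dvd_of_ringOfIntegers_dvd {n c : ℤ} (h : (n : 𝓞 K) ∣ (c : 𝓞 K)) : n ∣ c := by
  have h1 : Ideal.span {(c : 𝓞 K)} ≤ Ideal.span {(n : 𝓞 K)} :=
    Ideal.span_singleton_le_span_singleton.mpr h
  have h2 := Ideal.absNorm_dvd_absNorm_of_le h1
  have h3 : ∀ z : ℤ, Ideal.absNorm (Ideal.span {(z : 𝓞 K)}) =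
      z.natAbs ^ Module.finrank ℤ (𝓞 K) := by
    intro z
    rw [Ideal.absNorm_span_singleton, ← eq_intCast (algebraMap ℤ (𝓞 K)),
      Algebra.norm_algebraMap, Int.natAbs_pow]
  rw [h3, h3, Nat.pow_dvd_pow_iff Module.finrank_pos.ne'] at h2
  exact Int.natAbs_dvd_natAbs.mp h2

theorem exists_int_eq_of_two_mul_re_eq {K : Type*} [Field K] (φ : K →+* ℂ) (γ : 𝓞 K) {q : ℚ}
    (h : 2 * (φ γ).re = q) : ∃ t : ℤ, (t : ℚ) = q := by
  have h1 : IsIntegral ℤ (φ γ) := (RingOfIntegers.isIntegral_coe γ).map (φ.toIntAlgHom)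
  have h2 : IsIntegral ℤ ((starRingEnd ℂ) (φ γ)) := h1.map ((starRingEnd ℂ).toIntAlgHom)
  have h3 : IsIntegral ℤ (algebraMap ℚ ℂ q) := by
    have h4 : algebraMap ℚ ℂ q = φ γ + (starRingEnd ℂ) (φ γ) := by
      rw [Complex.add_conj, h]
      simp
    rw [h4]
    exact h1.add h2
  rw [isIntegral_algebraMap_iff (algebraMap ℚ ℂ).injective] at h3
  obtain ⟨t, ht⟩ := IsIntegrallyClosed.isIntegral_iff.mp h3
  exact ⟨t, by simpa using ht⟩

theorem exists_prime_ideals_mul_eq_span (hK : Module.finrank ℚ K = 2) {p : ℕ} (hp : p.Prime)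
    {x y : 𝓞 K} (hxy : (p : 𝓞 K) ∣ x * y) (hx : ¬ (p : 𝓞 K) ∣ x) (hy : ¬ (p : 𝓞 K) ∣ y) :
    ∃ P Q : Ideal (𝓞 K), Prime P ∧ Prime Q ∧ Ideal.absNorm P = p ∧ Ideal.absNorm Q = p ∧
      P * Q = Ideal.span {(p : 𝓞 K)} := by
  have hp0 : (p : 𝓞 K) ≠ 0 := Nat.cast_ne_zero.mpr hp.ne_zero
  have hnorm : Ideal.absNorm (Ideal.span {(p : 𝓞 K)}) = p ^ 2 := by
    rw [Ideal.absNorm_span_singleton, ← map_natCast (algebraMap ℤ (𝓞 K)),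
      Algebra.norm_algebraMap, RingOfIntegers.rank, hK]
    simp [Int.natAbs_pow]
  have htop : Ideal.span {(p : 𝓞 K)} ≠ ⊤ := by
    rw [Ne, ← Ideal.absNorm_eq_one_iff, hnorm]
    exact (Nat.one_lt_pow two_ne_zero hp.one_lt).ne'
  have hnp : ¬ (Ideal.span {(p : 𝓞 K)}).IsPrime := by
    rw [Ideal.span_singleton_prime hp0]
    intro h
    exact (h.dvd_or_dvd hxy).elim hx hy
  obtain ⟨P, hPmax, hP⟩ := Ideal.exists_le_maximal _ htop
  obtain ⟨Q, hQ⟩ := Ideal.dvd_iff_le.mpr hP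
  have hmul : Ideal.absNorm P * Ideal.absNorm Q = p ^ 2 := by rw [← map_mul, ← hQ, hnorm]
  have hP1 : Ideal.absNorm P ≠ 1 := by
    rw [Ne, Ideal.absNorm_eq_one_iff]; exact hPmax.ne_top
  have hQ1 : Ideal.absNorm Q ≠ 1 := by
    rw [Ne, Ideal.absNorm_eq_one_iff]
    intro h
    rw [h, Ideal.mul_top] at hQ
    exact hnp (hQ ▸ hPmax.isPrime)
  obtain ⟨hPp, hQp⟩ := (hp.mul_eq_prime_sq_iff hP1 hQ1).mp hmul
  have hprime : ∀ I : Ideal (𝓞 K), Ideal.absNorm I = p → Prime I := by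
    intro I hI
    refine Ideal.prime_of_isPrime ?_ (Ideal.isPrime_of_irreducible_absNorm (hI ▸ hp))
    rintro rfl
    rw [Ideal.absNorm_bot] at hI
    exact hp.ne_zero hI.symm
  exact ⟨P, Q, hprime P hPp, hprime Q hQp, hPp, hQp, hQ.symm⟩

theorem exists_finset_card_eq_one (hK : Module.finrank ℚ K = 2) {p : ℕ} (hp : p.Prime)
    {x : 𝓞 K} (hxx : (p : 𝓞 K) ∣ x * x) (hx : ¬ (p : 𝓞 K) ∣ x) :
    ∃ S : Finset (Ideal (𝓞 K)), (∀ P ∈ S, Prime P ∧ Ideal.absNorm P = p) ∧ S.card = 1 := by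
  obtain ⟨P, -, hP, -, hPp, -⟩ := exists_prime_ideals_mul_eq_span hK hp hxx hx hx
  exact ⟨{P}, by simpa using ⟨hP, hPp⟩, Finset.card_singleton P⟩

theorem exists_finset_card_eq_two (hK : Module.finrank ℚ K = 2) {p : ℕ} (hp : p.Prime)
    {x y : 𝓞 K} (hxy : (p : 𝓞 K) ∣ x * y) (hx : ¬ (p : 𝓞 K) ∣ x) (hy : ¬ (p : 𝓞 K) ∣ y)
    {c : ℤ} (hc : y - x = c) (hpc : ¬ (p : ℤ) ∣ c) :
    ∃ S : Finset (Ideal (𝓞 K)), (∀ P ∈ S, Prime P ∧ Ideal.absNorm P = p) ∧ S.card = 2 := by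
  classical
  obtain ⟨P, Q, hP, hQ, hPp, hQp, hPQ⟩ := exists_prime_ideals_mul_eq_span hK hp hxy hx hy
  have hne : P ≠ Q := by
    rintro rfl
    have hpP : (p : 𝓞 K) ∈ P :=
      Ideal.dvd_span_singleton.mp (Dvd.intro _ hPQ)
    have hnot : ¬ (P ∣ Ideal.span {x} ∧ P ∣ Ideal.span {y}) := by
      rw [Ideal.dvd_span_singleton, Ideal.dvd_span_singleton]
      rintro ⟨h1, h2⟩
      have h3 : (c : 𝓞 K) ∈ P := hc ▸ sub_mem h2 h1
      have hcop : IsCoprime (p : ℤ) c :=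
        (Nat.prime_iff_prime_int.mp hp).coprime_iff_not_dvd.mpr hpc
      obtain ⟨u, v, huv⟩ := hcop
      have h4 : (1 : 𝓞 K) ∈ P := by
        have : (1 : 𝓞 K) = u * p + v * c := by exact_mod_cast congrArg (Int.cast : ℤ → 𝓞 K) huv.symm
        rw [this]
        exact add_mem (P.mul_mem_left _ hpP) (P.mul_mem_left _ h3)
      exact hP.not_isUnit (Ideal.isUnit_iff.mpr ((Ideal.eq_top_iff_one _).mpr h4))
    have hdvd : P ^ 2 ∣ Ideal.span {x} * Ideal.span {y} := by
      rw [pow_two, hPQ, Ideal.span_singleton_mul_span_singleton, Ideal.dvd_span_singleton,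
        Ideal.mem_span_singleton]
      exact hxy
    have hP2 : ∀ z : 𝓞 K, P ^ 2 ∣ Ideal.span {z} → (p : 𝓞 K) ∣ z := by
      intro z hz
      rwa [pow_two, hPQ, Ideal.dvd_span_singleton, Ideal.mem_span_singleton] at hz
    by_cases h : P ∣ Ideal.span {x}
    · exact hx (hP2 x (hP.pow_dvd_of_dvd_mul_right 2 (fun h' => hnot ⟨h, h'⟩) hdvd))
    · exact hy (hP2 y (hP.pow_dvd_of_dvd_mul_left 2 h hdvd))
  refine ⟨{P, Q}, ?_, Finset.card_pair hne⟩
  intro I hI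
  rcases Finset.mem_insert.mp hI with rfl | hI
  · exact ⟨hP, hPp⟩
  · rw [Finset.mem_singleton.mp hI]; exact ⟨hQ, hQp⟩

variable {Δ : ℤ}

theorem exists_finset_card_eq_of_odd (hK : Module.finrank ℚ K = 2)
    (hfd : IsFundamentalDiscriminant Δ) {a : 𝓞 K} (ha : a ^ 2 = (Δ : 𝓞 K)) {φ : K →+* ℂ}
    (hφ : (φ a).re = 0) {p : ℕ} (hp : p.Prime) (hp2 : p ≠ 2) :
    ∃ S : Finset (Ideal (𝓞 K)), (∀ P ∈ S, Prime P ∧ Ideal.absNorm P = p) ∧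
      (S.card : ℤ) = 1 + jacobiSym Δ p := by
  have : Fact p.Prime := ⟨hp⟩
  rw [← jacobiSym.legendreSym.to_jacobiSym]
  have hpint := Nat.prime_iff_prime_int.mp hp
  have hp2' : ¬ (p : ℤ) ∣ 2 := by
    intro h
    exact hp2 ((Nat.prime_dvd_prime_iff_eq hp Nat.prime_two).mp (by exact_mod_cast h))
  by_cases h0 : (Δ : ZMod p) = 0
  · rw [(legendreSym.eq_zero_iff p Δ).mpr h0]
    have hpΔ : (p : ℤ) ∣ Δ := (ZMod.intCast_zmod_eq_zero_iff_dvd Δ p).mp h0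
    obtain ⟨S, hS, hS1⟩ := exists_finset_card_eq_one hK hp (x := a)
      (by
        rw [← pow_two, ha]
        obtain ⟨k, rfl⟩ := hpΔ
        exact ⟨k, by push_cast; rfl⟩)
      (by
        rintro ⟨γ, rfl⟩
        have h1 : (p : ℤ) * p ∣ Δ := int_dvd_of_ringOfIntegers_dvd (K := K)
          ⟨γ ^ 2, by rw [← ha]; push_cast; ring⟩
        rcases hfd with ⟨-, hsq⟩ | ⟨h4, hsq, -⟩
        · exact hpint.not_isUnit (hsq _ h1)
        · have h2 : Δ = 2 ^ 2 * (Δ / 4) := by omega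
          rw [h2, ← pow_two] at h1
          have hcop : IsCoprime ((p : ℤ) ^ 2) (2 ^ 2) :=
            (hpint.coprime_iff_not_dvd.mpr hp2').pow
          have h3 := hcop.dvd_of_dvd_mul_left h1
          rw [pow_two] at h3
          exact hpint.not_isUnit (hsq _ h3))
    exact ⟨S, hS, by rw [hS1]; norm_num⟩
  · rcases legendreSym.eq_one_or_neg_one p h0 with h1 | h1
    · rw [h1]
      obtain ⟨b', hb'⟩ := (legendreSym.eq_one_iff p h0).mp h1
      obtain ⟨b, rfl⟩ := ZMod.intCast_surjective b'
      have hdvd : (p : ℤ) ∣ Δ - b * b := by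
        rw [← ZMod.intCast_zmod_eq_zero_iff_dvd]
        push_cast
        rw [hb', sub_self]
      have hpb : ¬ (p : ℤ) ∣ 2 * b := by
        intro h
        have hb0 : (b : ZMod p) = 0 := (ZMod.intCast_zmod_eq_zero_iff_dvd b p).mpr
          ((hpint.dvd_or_dvd h).resolve_left hp2')
        exact h0 (by rw [hb', hb0, mul_zero])
      have hnot : ∀ d : ℤ, ¬ (p : ℤ) ∣ 2 * d → ¬ (p : 𝓞 K) ∣ a + d := by
        rintro d hd ⟨γ, hγ⟩
        have hγ' := congrArg (fun z : 𝓞 K => (φ z).re) hγ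
        simp [hφ] at hγ'
        have hp0 : (p : ℝ) ≠ 0 := Nat.cast_ne_zero.mpr hp.ne_zero
        obtain ⟨t, ht⟩ := exists_int_eq_of_two_mul_re_eq φ γ (q := 2 * d / p) (by
          push_cast
          rw [eq_div_iff hp0, hγ']
          ring)
        rw [eq_div_iff (Nat.cast_ne_zero.mpr hp.ne_zero)] at ht
        exact hd ⟨t, by rw [mul_comm (p : ℤ)]; exact_mod_cast ht.symm⟩
      obtain ⟨S, hS, hS2⟩ := exists_finset_card_eq_two hK hp (x := a + (-b : ℤ)) (y := a + b)
        (by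
          obtain ⟨k, hk⟩ := hdvd
          refine ⟨k, ?_⟩
          have hk' := congrArg (Int.cast : ℤ → 𝓞 K) hk
          push_cast at hk' ⊢
          rw [← hk', ← ha]
          ring)
        (hnot _ (by rwa [mul_neg, dvd_neg])) (hnot _ hpb) (c := 2 * b) (by push_cast; ring) hpb
      exact ⟨S, hS, by rw [hS2]; norm_num⟩
    · exact ⟨∅, by simp, by rw [h1]; simp⟩

theorem exists_finset_card_eq_of_two (hK : Module.finrank ℚ K = 2)
    (hfd : IsFundamentalDiscriminant Δ) {α : K} (hα : α ^ 2 = (Δ : K)) {φ : K →+* ℂ}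
    (hφ : (φ α).re = 0) :
    ∃ S : Finset (Ideal (𝓞 K)), (∀ P ∈ S, Prime P ∧ Ideal.absNorm P = 2) ∧
      (S.card : ℤ) = 1 + kroneckerAtPrime Δ 2 := by
  rcases hfd with ⟨h1, -⟩ | ⟨h0, -, hm⟩
  · rcases (by omega : Δ % 8 = 1 ∨ Δ % 8 = 5) with h8 | h8
    · have hk : kroneckerAtPrime Δ 2 = 1 := by
        simp [kroneckerAtPrime, h8, (by omega : Δ % 2 = 1)]
      obtain ⟨k, hk8⟩ : ∃ k, Δ = 8 * k + 1 := ⟨Δ / 8, by omega⟩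
      have hω : IsIntegral ℤ ((1 + α) / 2) := by
        refine ⟨Polynomial.X ^ 2 - Polynomial.X - Polynomial.C (2 * k), by monicity!, ?_⟩
        have hα' : α ^ 2 = 8 * (k : K) + 1 := by rw [hα, hk8]; push_cast; rfl
        simp only [Polynomial.eval₂_sub, Polynomial.eval₂_pow, Polynomial.eval₂_X,
          Polynomial.eval₂_C, algebraMap_int_eq, Int.coe_castRingHom]
        push_cast
        linear_combination (1 / 4 : K) * hα'
      let ω : 𝓞 K := ⟨(1 + α) / 2, hω⟩
      have hωre : (φ ω).re = 1 / 2 := by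
        change (φ ((1 + α) / 2)).re = 1 / 2
        rw [map_div₀, map_add, map_one, map_ofNat, Complex.div_ofNat_re, Complex.add_re, hφ]
        simp
      have hnot : ∀ d : ℤ, ¬ ((2 : ℕ) : 𝓞 K) ∣ ω + d := by
        rintro d ⟨γ, hγ⟩
        have hγ' := congrArg (fun z : 𝓞 K => (φ z).re) hγ
        have h2 : φ (algebraMap (𝓞 K) K 2) = 2 := by rw [map_ofNat, map_ofNat]
        simp [hωre, h2] at hγ'
        obtain ⟨t, ht⟩ := exists_int_eq_of_two_mul_re_eq φ γ (q := 1 / 2 + d) (by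
          push_cast
          linarith)
        have ht' : ((2 * t : ℤ) : ℚ) = ((1 + 2 * d : ℤ) : ℚ) := by push_cast; linarith
        have := Int.cast_injective ht'
        omega
      obtain ⟨S, hS, hS2⟩ := exists_finset_card_eq_two hK Nat.prime_two
        (x := ω + (-1 : ℤ)) (y := ω + (0 : ℤ))
        ⟨k, by
          apply RingOfIntegers.ext
          have hα' : α ^ 2 = 8 * (k : K) + 1 := by rw [hα, hk8]; push_cast; rfl
          have hωK : algebraMap (𝓞 K) K ω = (1 + α) / 2 := rfl
          change algebraMap (𝓞 K) K ((ω + (-1 : ℤ)) * (ω + (0 : ℤ))) =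
            algebraMap (𝓞 K) K (((2 : ℕ) : 𝓞 K) * k)
          simp only [map_mul, map_add, map_intCast, map_natCast, hωK]
          push_cast
          linear_combination (1 / 4 : K) * hα'⟩
        (hnot _) (hnot _) (c := 1) (by push_cast; ring) (by norm_num)
      exact ⟨S, hS, by rw [hS2, hk]; norm_num⟩
    · have hk : kroneckerAtPrime Δ 2 = -1 := by
        simp [kroneckerAtPrime, h8, (by omega : Δ % 2 = 1)]
      exact ⟨∅, by simp, by simp [hk]⟩
  · have hk : kroneckerAtPrime Δ 2 = 0 := by
      simp [kroneckerAtPrime, (by omega : Δ % 2 = 0)]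
    obtain ⟨m, rfl⟩ : ∃ m, Δ = 4 * m := ⟨Δ / 4, by omega⟩
    rw [Int.mul_ediv_cancel_left m (by norm_num)] at hm
    have hβ2 : (α / 2) ^ 2 = (m : K) := by
      push_cast at hα
      linear_combination (1 / 4 : K) * hα
    have hβ : IsIntegral ℤ (α / 2) :=
      .of_pow two_pos (hβ2 ▸ isIntegral_algebraMap (x := m))
    let β : 𝓞 K := ⟨α / 2, hβ⟩
    have hββ : β ^ 2 = (m : 𝓞 K) := by
      apply RingOfIntegers.ext
      change algebraMap (𝓞 K) K (β ^ 2) = algebraMap (𝓞 K) K m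
      rw [map_pow, map_intCast]
      exact hβ2
    have hex : ∃ x : 𝓞 K, ((2 : ℕ) : 𝓞 K) ∣ x * x ∧ ¬ ((2 : ℕ) : 𝓞 K) ∣ x := by
      rcases hm with hm | hm
      · refine ⟨β, ⟨((m / 2 : ℤ) : 𝓞 K), ?_⟩, ?_⟩
        · rw [← pow_two, hββ]
          exact_mod_cast congrArg (Int.cast : ℤ → 𝓞 K) (by omega : m = 2 * (m / 2))
        · rintro ⟨γ, hγ⟩
          have h4 : (4 : ℤ) ∣ m := int_dvd_of_ringOfIntegers_dvd (K := K)
            ⟨γ ^ 2, by rw [← hββ, hγ]; push_cast; ring⟩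
          omega
      · refine ⟨β + 1, ⟨(((m + 1) / 2 : ℤ) : 𝓞 K) + β, ?_⟩, ?_⟩
        · have h2 : (m : 𝓞 K) + 1 = 2 * (((m + 1) / 2 : ℤ) : 𝓞 K) := by
            exact_mod_cast congrArg (Int.cast : ℤ → 𝓞 K) (by omega : m + 1 = 2 * ((m + 1) / 2))
          push_cast
          linear_combination hββ + h2
        · rintro ⟨γ, hγ⟩
          have h4 : (4 : ℤ) ∣ m - 1 := int_dvd_of_ringOfIntegers_dvd (K := K)
            ⟨γ ^ 2 - γ, by
              push_cast at hγ ⊢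
              linear_combination (-1 : 𝓞 K) * hββ + (β + 2 * γ - 1) * hγ⟩
          omega
    obtain ⟨x, hxx, hx⟩ := hex
    obtain ⟨S, hS, hS1⟩ := exists_finset_card_eq_one hK Nat.prime_two hxx hx
    exact ⟨S, hS, by rw [hS1, hk]; norm_num⟩

theorem exists_finset_card_eq_one_add_kronecker (hK : Module.finrank ℚ K = 2)
    (hfd : IsFundamentalDiscriminant Δ) {α : K} (hα : α ^ 2 = (Δ : K)) {φ : K →+* ℂ}
    (hφ : (φ α).re = 0) {p : ℕ} (hp : p.Prime) :
    ∃ S : Finset (Ideal (𝓞 K)), (∀ P ∈ S, Prime P ∧ Ideal.absNorm P = p) ∧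
      (S.card : ℤ) = 1 + kroneckerAtPrime Δ p := by
  by_cases hp2 : p = 2
  · subst hp2
    exact exists_finset_card_eq_of_two hK hfd hα hφ
  · rw [kroneckerAtPrime, if_neg hp2]
    have hαint : IsIntegral ℤ α :=
      .of_pow two_pos (hα ▸ isIntegral_algebraMap (x := Δ))
    let a : 𝓞 K := ⟨α, hαint⟩
    have ha : a ^ 2 = (Δ : 𝓞 K) := by
      apply RingOfIntegers.ext
      change algebraMap (𝓞 K) K (a ^ 2) = algebraMap (𝓞 K) K Δ
      rw [map_pow, map_intCast]
      exact hα
    exact exists_finset_card_eq_of_odd hK hfd ha hφ hp hp2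

end PrimeSplitting

theorem half_le_prod_primesLE_one_sub_inv_sq (n : ℕ) :
    1 / 2 ≤ ∏ p ∈ n.primesLE, (1 - (p : ℝ)⁻¹ ^ 2) := by
  have h1 : n.primesLE = (Finset.Icc 2 n).filter Nat.Prime := by
    ext p
    simp only [Nat.mem_primesLE, Finset.mem_filter, Finset.mem_Icc]
    exact ⟨fun h => ⟨⟨h.2.two_le, h.1⟩, h.2⟩, fun h => ⟨h.1.2, h.2⟩⟩
  have h2 : ∀ k ∈ Finset.Icc 2 n, 0 ≤ 1 - (k : ℝ)⁻¹ ^ 2 ∧ 1 - (k : ℝ)⁻¹ ^ 2 ≤ 1 := by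
    intro k hk
    have hk1 : (1 : ℝ) ≤ k := by
      exact_mod_cast one_le_two.trans (Finset.mem_Icc.mp hk).1
    have := pow_le_one₀ (n := 2) (by positivity) (inv_le_one_of_one_le₀ hk1)
    exact ⟨by linarith, by linarith [sq_nonneg (k : ℝ)⁻¹]⟩
  have h3 : ∏ k ∈ Finset.Icc 2 n, (1 - (k : ℝ)⁻¹ ^ 2) ≤
      ∏ p ∈ n.primesLE, (1 - (p : ℝ)⁻¹ ^ 2) := by
    rw [h1, Finset.prod_filter]
    refine Finset.prod_le_prod (fun k hk => (h2 k hk).1) fun k hk => ?_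
    split_ifs
    · exact le_rfl
    · exact (h2 k hk).2
  refine le_trans ?_ h3
  have h4 : ∀ n : ℕ, ∏ k ∈ Finset.Icc 2 (n + 1), (1 - (k : ℝ)⁻¹ ^ 2) =
      ((n : ℝ) + 2) / (2 * (n + 1)) := by
    intro n
    induction n with
    | zero => norm_num
    | succ n ih =>
      rw [Finset.prod_Icc_succ_top (by omega), ih]
      push_cast
      field_simp
      ring
  rcases n with _ | n
  · norm_num
  · rw [h4, div_le_div_iff₀ (by norm_num) (by positivity)]
    linarith

theorem one_sub_pow_mul_one_sub_sq_le {t : ℝ} (ht1 : t ≤ 1) {c : ℤ}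
    (hc : c = 0 ∨ c = 1 ∨ c = -1) {s : ℕ} (hs : (s : ℤ) = 1 + c) :
    (1 - t) ^ s * (1 - t ^ 2) ≤ (1 - t) * (1 - c * t) := by
  rcases hc with rfl | rfl | rfl
  · obtain rfl : s = 1 := by omega
    push_cast
    nlinarith [mul_nonneg (sub_nonneg.mpr ht1) (sq_nonneg t)]
  · obtain rfl : s = 2 := by omega
    push_cast
    nlinarith [mul_nonneg (sq_nonneg (1 - t)) (sq_nonneg t)]
  · obtain rfl : s = 0 := by omega
    push_cast
    exact le_of_eq (by ring)

theorem prod_one_sub_rpow_neg_pow_le {n : ℕ} (hn : 2 ≤ n) {s : ℕ → ℕ}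
    (hs : ∀ p ∈ n.primesLE, s p ≤ 2) :
    ∏ p ∈ n.primesLE, (1 - (p : ℝ) ^ (-(1 + 1 / Real.log n))) ^ s p ≤
      (∏ p ∈ n.primesLE, (1 - (p : ℝ)⁻¹) ^ s p) * Real.exp 12 := by
  have hn2 : (2 : ℝ) ≤ n := by exact_mod_cast hn
  have hlog2 : 0 < Real.log 2 := Real.log_pos one_lt_two
  have hlog : Real.log 2 ≤ Real.log n := Real.log_le_log two_pos hn2
  have hlogn : 0 < Real.log n := hlog2.trans_le hlog
  set δ := 1 / Real.log n with hδ
  have hδ0 : 0 < δ := by positivity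
  have hp2 : ∀ p ∈ n.primesLE, (2 : ℝ) ≤ p := fun p hp => by
    exact_mod_cast (Nat.mem_primesLE.mp hp).2.two_le
  have hterm : ∀ p ∈ n.primesLE, (1 - (p : ℝ) ^ (-(1 + δ))) ^ s p ≤
      (1 - (p : ℝ)⁻¹) ^ s p * Real.exp (4 * δ * (Real.log p / p)) := by
    intro p hp
    have h2 := hp2 p hp
    have h0 : 0 ≤ 1 - (p : ℝ) ^ (-(1 + δ)) :=
      sub_nonneg.mpr (Real.rpow_le_one_of_one_le_of_nonpos (by linarith) (by linarith))
    have h1 : 0 ≤ 1 - (p : ℝ)⁻¹ := sub_nonneg.mpr (inv_le_one_of_one_le₀ (by linarith))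
    have h3 : 0 ≤ Real.log p / p := div_nonneg (Real.log_nonneg (by linarith)) (by linarith)
    refine (pow_le_pow_left₀ h0 (one_sub_rpow_neg_le h2 hδ0.le) _).trans ?_
    rw [mul_pow, ← Real.exp_nat_mul]
    refine mul_le_mul_of_nonneg_left (Real.exp_le_exp.mpr ?_) (pow_nonneg h1 _)
    have hs2 : (s p : ℝ) ≤ 2 := by exact_mod_cast hs p hp
    have h4 : 0 ≤ δ * (Real.log p / p) := by positivity
    nlinarith
  refine (Finset.prod_le_prod (fun p hp => ?_) hterm).trans ?_
  · have h2 := hp2 p hp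
    exact pow_nonneg (sub_nonneg.mpr
      (Real.rpow_le_one_of_one_le_of_nonpos (by linarith) (by linarith))) _
  · rw [Finset.prod_mul_distrib, ← Real.exp_sum, ← Finset.mul_sum]
    refine mul_le_mul_of_nonneg_left (Real.exp_le_exp.mpr ?_) (Finset.prod_nonneg fun p hp =>
      pow_nonneg (sub_nonneg.mpr (inv_le_one_of_one_le₀ (by linarith [hp2 p hp]))) _)
    have h4 : Real.log 4 = 2 * Real.log 2 := by
      rw [show (4 : ℝ) = 2 ^ 2 by norm_num, Real.log_pow]
      norm_num
    calc 4 * δ * ∑ p ∈ n.primesLE, Real.log p / p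
        ≤ 4 * δ * (3 * Real.log n) := by
          refine mul_le_mul_of_nonneg_left ?_ (by positivity)
          linarith [sum_primesLE_log_div_le (n := n) (by omega)]
      _ = 12 := by
          rw [hδ]
          field_simp
          norm_num

theorem div_le_prod_one_sub_div {n : ℕ} (hn : 2 ≤ n) {s : ℕ → ℕ} {χ : ℕ → ℤ} {H : ℝ}
    (hH : 0 < H) (hχ : ∀ p ∈ n.primesLE, χ p = 0 ∨ χ p = 1 ∨ χ p = -1)
    (hs : ∀ p ∈ n.primesLE, (s p : ℤ) = 1 + χ p)
    (hprod : ∏ p ∈ n.primesLE, ((1 - (p : ℝ) ^ (-(1 + 1 / Real.log n))) ^ s p)⁻¹ ≤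
      H * (1 + Real.log n)) :
    Real.log 2 / (1 + Real.log 2) / (2 * Real.exp 12) / H ≤
      ∏ p ∈ n.primesLE, (1 - (χ p : ℝ) / p) := by
  have hn2 : (2 : ℝ) ≤ n := by exact_mod_cast hn
  have hlog2 : 0 < Real.log 2 := Real.log_pos one_lt_two
  have hlog : Real.log 2 ≤ Real.log n := Real.log_le_log two_pos hn2
  have hlogn : 0 < Real.log n := hlog2.trans_le hlog
  have hp2 : ∀ p ∈ n.primesLE, (2 : ℝ) ≤ p := fun p hp => by
    exact_mod_cast (Nat.mem_primesLE.mp hp).2.two_le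
  have hinv : ∀ p ∈ n.primesLE, 0 ≤ (p : ℝ)⁻¹ ∧ (p : ℝ)⁻¹ < 1 := fun p hp =>
    ⟨by positivity, inv_lt_one_of_one_lt₀ (by linarith [hp2 p hp])⟩
  set A := ∏ p ∈ n.primesLE, (1 - (p : ℝ)⁻¹) ^ s p
  set B := ∏ p ∈ n.primesLE, (1 - (p : ℝ)⁻¹)
  set F := ∏ p ∈ n.primesLE, (1 - (χ p : ℝ) / p)
  set E := ∏ p ∈ n.primesLE, (1 - (p : ℝ) ^ (-(1 + 1 / Real.log n))) ^ s p
  have hE : 0 < E := Finset.prod_pos fun p hp => pow_pos (sub_pos.mpr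
    (Real.rpow_lt_one_of_one_lt_of_neg (by linarith [hp2 p hp])
      (by have : 0 < 1 / Real.log n := by positivity
          linarith))) _
  have hB : 0 < B := Finset.prod_pos fun p hp => sub_pos.mpr (hinv p hp).2
  have hA : 0 < A := Finset.prod_pos fun p hp => pow_pos (sub_pos.mpr (hinv p hp).2) _
  have hEA : E ≤ A * Real.exp 12 := prod_one_sub_rpow_neg_pow_le hn fun p hp => by
    have := hs p hp
    rcases hχ p hp with h | h | h <;> omega
  have hEH : 1 ≤ H * (1 + Real.log n) * E := by
    rw [Finset.prod_inv_distrib] at hprod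
    rwa [inv_le_iff_one_le_mul₀ hE] at hprod
  have hBn : Real.log n * B ≤ 1 := by
    have h := log_le_prod_primesLE_inv n
    rw [Finset.prod_inv_distrib] at h
    exact (le_inv_mul_iff₀' hB).mp (by simpa using h)
  have hAB : A * (1 / 2) ≤ B * F := by
    calc A * (1 / 2) ≤ A * ∏ p ∈ n.primesLE, (1 - (p : ℝ)⁻¹ ^ 2) :=
          mul_le_mul_of_nonneg_left (half_le_prod_primesLE_one_sub_inv_sq n) hA.le
      _ = ∏ p ∈ n.primesLE, (1 - (p : ℝ)⁻¹) ^ s p * (1 - (p : ℝ)⁻¹ ^ 2) :=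
          Finset.prod_mul_distrib.symm
      _ ≤ ∏ p ∈ n.primesLE, (1 - (p : ℝ)⁻¹) * (1 - (χ p : ℝ) / p) := by
          refine Finset.prod_le_prod (fun p hp => ?_) fun p hp => ?_
          · obtain ⟨h0, h1⟩ := hinv p hp
            exact mul_nonneg (pow_nonneg (sub_nonneg.mpr h1.le) _)
              (sub_nonneg.mpr (pow_le_one₀ h0 h1.le))
          · rw [div_eq_mul_inv]
            exact one_sub_pow_mul_one_sub_sq_le (hinv p hp).2.le (hχ p hp) (hs p hp)
      _ = B * F := Finset.prod_mul_distrib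
  have hF : 0 < F := pos_of_mul_pos_right (lt_of_lt_of_le (by positivity) hAB) hB.le
  have h1 : Real.log n * A ≤ 2 * F := by nlinarith
  have h2 : Real.log 2 / (1 + Real.log 2) ≤ Real.log n / (1 + Real.log n) := by
    rw [div_le_div_iff₀ (by positivity) (by positivity)]
    linarith
  rw [div_div, div_le_iff₀ (by positivity)]
  refine h2.trans ((div_le_iff₀ (by positivity)).mpr ?_)
  have h3 : 1 ≤ H * (1 + Real.log n) * (A * Real.exp 12) :=
    hEH.trans (mul_le_mul_of_nonneg_left hEA (by positivity))
  calc Real.log n ≤ Real.log n * (H * (1 + Real.log n) * (A * Real.exp 12)) :=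
        le_mul_of_one_le_right hlogn.le h3
    _ = Real.log n * A * (H * (1 + Real.log n) * Real.exp 12) := by ring
    _ ≤ 2 * F * (H * (1 + Real.log n) * Real.exp 12) :=
        mul_le_mul_of_nonneg_right h1 (by positivity)
    _ = F * (2 * Real.exp 12 * H) * (1 + Real.log n) := by ring

theorem kroneckerAtPrime_trichotomy (Δ : ℤ) (p : ℕ) :
    kroneckerAtPrime Δ p = 0 ∨ kroneckerAtPrime Δ p = 1 ∨ kroneckerAtPrime Δ p = -1 := by
  unfold kroneckerAtPrime
  split_ifs
  · simp
  · simp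
  · simp
  · exact jacobiSym.trichotomy Δ p

/-- There is an effective absolute constant `C > 0` such that for every
fundamental quadratic discriminant `Δ < 0`, with `K = ℚ(√Δ)`, `h_K` the class number of `K`,
and `χ = (Δ/·)` the Kronecker symbol, one has `∏_{p ≤ x} (1 − χ(p)/p) ≥ C / h_K` for all
real `x ≥ 2`. -/
theorem prod_one_sub_chi_div_p_ge :
    ∃ C : ℝ, 0 < C ∧
      ∀ Δ : ℤ, Δ < 0 → IsFundamentalDiscriminant Δ →
        ∀ (K : Type) [Field K] [NumberField K],
          Module.finrank ℚ K = 2 → (∃ α : K, α ^ 2 = (Δ : K)) →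
          ∀ x : ℝ, 2 ≤ x →
            C / (NumberField.classNumber K) ≤
              ∏ p ∈ (Finset.range (⌊x⌋₊ + 1)).filter (fun p : ℕ => p.Prime ∧ (p : ℝ) ≤ x),
                (1 - (kroneckerAtPrime Δ p : ℝ) / p) := by
  classical
  have hlog2 : 0 < Real.log 2 := Real.log_pos one_lt_two
  refine ⟨Real.log 2 / (1 + Real.log 2) / (2 * Real.exp 12) / 64, by positivity, ?_⟩
  intro Δ hΔ hfd K _ _ hK ⟨α, hα⟩ x hx
  have hset : (Finset.range (⌊x⌋₊ + 1)).filter (fun p : ℕ => p.Prime ∧ (p : ℝ) ≤ x) =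
      ⌊x⌋₊.primesLE := by
    ext p
    simp only [Finset.mem_filter, Finset.mem_range, Nat.mem_primesLE, Nat.lt_succ_iff,
      ← Nat.le_floor_iff (zero_le_two.trans hx)]
    tauto
  rw [hset]
  have hn : 2 ≤ ⌊x⌋₊ := Nat.le_floor (by exact_mod_cast hx)
  generalize ⌊x⌋₊ = n at hn
  obtain ⟨φ, hφre, hφ⟩ := exists_embedding_sq_norm_eq_abs_norm hK hΔ hα
  have hex : ∀ p : ℕ, ∃ S : Finset (Ideal (NumberField.RingOfIntegers K)),
      (∀ P ∈ S, Prime P ∧ Ideal.absNorm P = p) ∧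
        (p.Prime → (S.card : ℤ) = 1 + kroneckerAtPrime Δ p) := by
    intro p
    by_cases hp : p.Prime
    · obtain ⟨S, hS, hcard⟩ := exists_finset_card_eq_one_add_kronecker hK hfd hα hφre hp
      exact ⟨S, hS, fun _ => hcard⟩
    · exact ⟨∅, by simp, fun h => absurd h hp⟩
  choose S hS hcard using hex
  have hdisj : (n.primesLE : Set ℕ).PairwiseDisjoint S := by
    intro p _ q _ hpq
    refine Finset.disjoint_left.mpr fun P hP hQ => hpq ?_
    rw [← (hS p P hP).2, (hS q P hQ).2]
  have hlogn : 0 < Real.log n := Real.log_pos (by exact_mod_cast hn)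
  have hbound := prod_one_sub_absNorm_rpow_neg_inv_le hφ (n.primesLE.biUnion S)
    (fun P hP => by
      obtain ⟨p, -, hP⟩ := Finset.mem_biUnion.mp hP
      exact (hS p P hP).1)
    (one_div_pos.mpr hlogn)
  rw [Finset.prod_biUnion hdisj, one_div_one_div] at hbound
  have hH : (0 : ℝ) < NumberField.classNumber K :=
    Nat.cast_pos.mpr (Nat.pos_of_ne_zero (NumberField.classNumber_ne_zero K))
  rw [div_div]
  refine div_le_prod_one_sub_div hn (s := fun p => (S p).card) (by positivity)
    (fun p _ => kroneckerAtPrime_trichotomy Δ p)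
    (fun p hp => hcard p (Nat.mem_primesLE.mp hp).2) (le_of_eq_of_le ?_ hbound)
  refine Finset.prod_congr rfl fun p _ => ?_
  rw [← inv_pow, ← Finset.prod_const]
  exact Finset.prod_congr rfl fun P hP => by rw [(hS p P hP).2]
end
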